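/- Let q ≥ 2 be an integer and let θ₄(q) := Σ_{n=0}^∞ q^{-n⁴}. Then θ₄(q) is not a root of any nonzero polynomial with integer coefficients of degree at most 4; equivalently, the numbers 1, θ₄(q), θ₄(q)², θ₄(q)³, θ₄(q)⁴ are linearly independent over ℚ. -/

import Mathlib

/-- The biquadratic theta value `θ₄(q) = ∑_{n=0}^∞ q^{-n⁴}`. -/
noncomputable def theta4 (q : ℕ) : ℝ := ∑' n : ℕ, (1 : ℝ) / (q : ℝ) ^ (n ^ 4)

/-- The number of representations of `b` as a sum of four fourth powers modulo `m`. -/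
noncomputable def biquadCount (m : ℕ) (b : ZMod m) : ℕ :=
  Nat.card {x : Fin 4 → ZMod m // ∑ i, x i ^ 4 = b}

section ExpSum

open Finset

variable {p : ℕ} [Fact p.Prime]

/-- The exponential sum of degree `k` modulo `p`. -/
noncomputable def powSum (k : ℕ) (t : ZMod p) : ℂ := ∑ x : ZMod p, ZMod.stdAddChar (t * x ^ k)

lemma sum_comp_mul_left {R : Type*} [AddCommMonoid R] (f : ZMod p → R) {c : ZMod p} (hc : c ≠ 0) :
    ∑ x : ZMod p, f (c * x) = ∑ x : ZMod p, f x :=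
  Equiv.sum_comp (Equiv.mulLeft₀ c hc) f

lemma sum_stdAddChar_mul (b : ZMod p) :
    ∑ t : ZMod p, ZMod.stdAddChar (t * b) = if b = 0 then (p : ℂ) else 0 := by
  have h := AddChar.sum_mulShift b (ZMod.isPrimitive_stdAddChar p)
  simpa [ZMod.card] using h

lemma biquadCount_mul_eq (b : ZMod p) :
    (biquadCount p b : ℂ) * p = ∑ t : ZMod p, ZMod.stdAddChar (-(t * b)) * powSum 4 t ^ 4 := by
  classical
  have h1 : ∀ t : ZMod p, ZMod.stdAddChar (-(t * b)) * powSum 4 t ^ 4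
      = ∑ x : Fin 4 → ZMod p, ZMod.stdAddChar (t * (∑ i, x i ^ 4 - b)) := by
    intro t
    rw [powSum, Fintype.sum_pow, Finset.mul_sum]
    refine Finset.sum_congr rfl fun x _ => ?_
    have h2 : ∏ i, (ZMod.stdAddChar (t * x i ^ 4) : ℂ)
        = ZMod.stdAddChar (∑ i, t * x i ^ 4) := by
      simp only [Fin.prod_univ_four, Fin.sum_univ_four, AddChar.map_add_eq_mul]
    rw [h2, ← AddChar.map_add_eq_mul, mul_sub, Finset.mul_sum]
    congr 1
    ring
  simp_rw [h1]
  rw [Finset.sum_comm]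
  simp_rw [sum_stdAddChar_mul, sub_eq_zero]
  rw [← Finset.sum_filter, Finset.sum_const, nsmul_eq_mul, biquadCount, Nat.card_eq_fintype_card,
    Fintype.card_subtype]

lemma conj_powSum (k : ℕ) (t : ZMod p) :
    (starRingEnd ℂ) (powSum k t) = powSum k (-t) := by
  simp_rw [powSum, map_sum, ← AddChar.map_neg_eq_conj, neg_mul]

lemma sum_comp_sq {R : Type*} [CommRing R] (hp : p ≠ 2) (h : ZMod p → R) :
    ∑ x : ZMod p, h (x ^ 2) = ∑ y : ZMod p, (1 + (quadraticChar (ZMod p) y : R)) * h y := by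
  classical
  have h0 : ringChar (ZMod p) ≠ 2 := by rwa [ZMod.ringChar_zmod_n]
  rw [← Finset.sum_fiberwise (s := Finset.univ) (g := fun x : ZMod p => x ^ 2)]
  refine Finset.sum_congr rfl fun y _ => ?_
  have h1 := quadraticChar_card_sqrts h0 y
  have h2 : ∑ x ∈ Finset.univ.filter (fun x : ZMod p => x ^ 2 = y), h (x ^ 2)
      = ∑ x ∈ Finset.univ.filter (fun x : ZMod p => x ^ 2 = y), h y :=
    Finset.sum_congr rfl fun x hx => by rw [(Finset.mem_filter.1 hx).2]
  rw [h2, Finset.sum_const, nsmul_eq_mul]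
  congr 1
  have h3 : ({x : ZMod p | x ^ 2 = y} : Set (ZMod p)).toFinset
      = Finset.univ.filter (fun x : ZMod p => x ^ 2 = y) := by ext; simp
  rw [h3] at h1
  have := congrArg (Int.cast : ℤ → R) h1
  push_cast at this
  rw [this, add_comm]

lemma exists_sq_eq_neg_one_not_isSquare (hp : p % 8 = 5) :
    ∃ i : ZMod p, i ^ 2 = -1 ∧ ¬ IsSquare i := by
  have h1 : IsSquare (-1 : ZMod p) := ZMod.exists_sq_eq_neg_one_iff.2 (by omega)
  obtain ⟨i, hi⟩ := h1
  refine ⟨i, by rw [hi, sq], ?_⟩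
  rintro ⟨j, rfl⟩
  have hne : (1 : ZMod p) ≠ -1 := by
    have : Fact (2 < p) := ⟨by
      have := (Fact.out : p.Prime).two_le
      omega⟩
    exact (ZMod.neg_one_ne_one (n := p)).symm
  have h8 : orderOf j = 2 ^ (2 + 1) := by
    refine orderOf_eq_prime_pow ?_ ?_
    · intro h
      apply hne
      rw [hi, ← h]; ring
    · have : j ^ 2 ^ (2 + 1) = (j * j * (j * j)) ^ 2 := by ring
      rw [this, ← hi]; ring
  have hj : j ≠ 0 := by rintro rfl; simp at hi
  have := orderOf_dvd_of_pow_eq_one (ZMod.pow_card_sub_one_eq_one hj)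
  rw [h8] at this
  omega

lemma normSq_powSum_two (hp : p ≠ 2) {t : ZMod p} (ht : t ≠ 0) :
    powSum 2 t * powSum 2 (-t) = p := by
  have h2 : (2 : ZMod p) ≠ 0 := by
    intro h
    have : (p : ℕ) ∣ 2 := (ZMod.natCast_eq_zero_iff 2 p).1 (by exact_mod_cast h)
    exact hp ((Nat.prime_dvd_prime_iff_eq Fact.out Nat.prime_two).1 this)
  rw [powSum, powSum, Finset.sum_mul_sum, Finset.sum_comm]
  have h1 : ∀ y : ZMod p, ∑ x : ZMod p, ZMod.stdAddChar (t * x ^ 2) * ZMod.stdAddChar (-t * y ^ 2)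
      = ∑ u : ZMod p, (ZMod.stdAddChar (t * u ^ 2) * ZMod.stdAddChar (y * (2 * t * u)) : ℂ) := by
    intro y
    rw [← Equiv.sum_comp (Equiv.addRight y) (fun x => (ZMod.stdAddChar (t * x ^ 2) *
      ZMod.stdAddChar (-t * y ^ 2) : ℂ))]
    refine Finset.sum_congr rfl fun u _ => ?_
    rw [← AddChar.map_add_eq_mul, ← AddChar.map_add_eq_mul]
    congr 1
    simp only [Equiv.coe_addRight]
    ring
  simp_rw [h1]
  rw [Finset.sum_comm]
  simp_rw [← Finset.mul_sum, sum_stdAddChar_mul]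
  simp [h2, ht]

lemma powSum_two_neg (hp : p % 8 = 5) (t : ZMod p) : powSum 2 (-t) = powSum 2 t := by
  obtain ⟨i, hi, -⟩ := exists_sq_eq_neg_one_not_isSquare hp
  have hi0 : i ≠ 0 := by rintro rfl; simp at hi
  rw [powSum, powSum, ← sum_comp_mul_left _ hi0]
  refine Finset.sum_congr rfl fun x _ => ?_
  congr 1
  rw [mul_pow, hi]; ring

lemma powSum_four_add_neg (hp : p % 8 = 5) (t : ZMod p) :
    powSum 4 t + powSum 4 (-t) = 2 * powSum 2 t := by
  obtain ⟨i, hi, hns⟩ := exists_sq_eq_neg_one_not_isSquare hp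
  have hi0 : i ≠ 0 := by rintro rfl; simp at hi
  have hp2 : p ≠ 2 := by rintro rfl; simp at hp
  have h1 : powSum 4 t = ∑ x : ZMod p, (fun y => (ZMod.stdAddChar (t * y ^ 2) : ℂ)) (x ^ 2) := by
    refine Finset.sum_congr rfl fun x _ => ?_
    congr 1; ring
  have h2 : powSum 4 (-t) = ∑ x : ZMod p, (fun y => (ZMod.stdAddChar (-t * y ^ 2) : ℂ)) (x ^ 2) := by
    refine Finset.sum_congr rfl fun x _ => ?_
    congr 1; ring
  rw [h1, h2, sum_comp_sq hp2 (fun y => (ZMod.stdAddChar (t * y ^ 2) : ℂ)),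
    sum_comp_sq hp2 (fun y => (ZMod.stdAddChar (-t * y ^ 2) : ℂ))]
  rw [← sum_comp_mul_left
    (fun y => (1 + ((quadraticChar (ZMod p) y : ℤ) : ℂ)) * (ZMod.stdAddChar (-t * y ^ 2) : ℂ)) hi0,
    ← Finset.sum_add_distrib, powSum, Finset.mul_sum]
  refine Finset.sum_congr rfl fun x _ => ?_
  rw [map_mul (quadraticChar (ZMod p)), quadraticChar_neg_one_iff_not_isSquare.2 hns, mul_pow, hi]
  have : -t * (-1 * x ^ 2) = t * x ^ 2 := by ring
  rw [this]
  push_cast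
  ring

lemma powSum_mul_pow (k : ℕ) (t : ZMod p) {v : ZMod p} (hv : v ≠ 0) :
    powSum k (t * v ^ k) = powSum k t := by
  rw [powSum, powSum, ← sum_comp_mul_left (fun x => (ZMod.stdAddChar (t * x ^ k) : ℂ)) hv]
  refine Finset.sum_congr rfl fun x _ => ?_
  congr 1
  ring

lemma powSum_zero_right {k : ℕ} : powSum k (0 : ZMod p) = p := by
  simp [powSum, ZMod.card]

lemma re_powSum_four_sq (hp : p % 8 = 5) {t : ZMod p} (ht : t ≠ 0) :
    (powSum 4 t).re ^ 2 = p := by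
  have hp2 : p ≠ 2 := by rintro rfl; simp at hp
  have h1 := powSum_four_add_neg hp t
  have h2 := normSq_powSum_two hp2 ht
  have h3 := powSum_two_neg hp t
  rw [← conj_powSum, Complex.add_conj] at h1
  have h4 : powSum 2 t = ((powSum 4 t).re : ℂ) := by
    have h5 : ((2 * (powSum 4 t).re : ℝ) : ℂ) = 2 * ((powSum 4 t).re : ℂ) := by push_cast; ring
    rw [h5] at h1
    exact (mul_left_cancel₀ two_ne_zero h1).symm
  rw [h3, h4] at h2
  rw [sq]
  exact_mod_cast h2

lemma im_sq_powSum_four_mul_sq (hp : p % 8 = 5) (t : ZMod p) {u : ZMod p} (hu : u ≠ 0) :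
    (powSum 4 (t * u ^ 2)).im ^ 2 = (powSum 4 t).im ^ 2 := by
  obtain ⟨i, hi, hns⟩ := exists_sq_eq_neg_one_not_isSquare hp
  have hi0 : i ≠ 0 := by rintro rfl; simp at hi
  by_cases hsq : IsSquare u
  · obtain ⟨v, rfl⟩ := hsq
    have hv : v ≠ 0 := by rintro rfl; simp at hu
    rw [show t * (v * v) ^ 2 = t * v ^ 4 by ring, powSum_mul_pow 4 t hv]
  · have h1 : IsSquare (u * i) := by
      rw [← quadraticChar_one_iff_isSquare (mul_ne_zero hu hi0), map_mul,
        quadraticChar_neg_one_iff_not_isSquare.2 hns, quadraticChar_neg_one_iff_not_isSquare.2 hsq]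
      norm_num
    obtain ⟨v, hv⟩ := h1
    have hv0 : v ≠ 0 := by
      rintro rfl
      rw [mul_zero] at hv
      exact mul_ne_zero hu hi0 hv
    have h2 : u ^ 2 = -v ^ 4 := by
      have : (u * i) ^ 2 = v ^ 4 := by rw [hv]; ring
      rw [mul_pow, hi] at this
      rw [← this]; ring
    rw [h2, show t * -v ^ 4 = (-t) * v ^ 4 by ring, powSum_mul_pow 4 _ hv0, ← conj_powSum]
    simp

lemma card_pow_four_eq (hp : p % 8 = 5) {y : ZMod p} (hy : y ≠ 0) :
    (Finset.univ.filter (fun x : ZMod p => x ^ 4 = y ^ 4)).card = 4 := by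
  classical
  obtain ⟨i, hi, hns⟩ := exists_sq_eq_neg_one_not_isSquare hp
  have h3 : Fact (2 < p) := ⟨by
    have := (Fact.out : p.Prime).two_le
    omega⟩
  have hne : (-1 : ZMod p) ≠ 1 := ZMod.neg_one_ne_one (n := p)
  have hi1 : i ≠ 1 := by rintro rfl; exact hne (by rw [← hi]; ring)
  have hi2 : i ≠ -1 := by rintro rfl; exact hne (by rw [← hi]; ring)
  have hi3 : i ≠ -i := by
    intro h
    apply hne
    rw [← hi, sq]
    nth_rw 1 [h]
    rw [neg_mul, ← sq, hi, neg_neg]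
  have hset : Finset.univ.filter (fun x : ZMod p => x ^ 4 = y ^ 4)
      = (({1, -1, i, -i} : Finset (ZMod p)).image (fun z => z * y)) := by
    ext x
    simp only [Finset.mem_filter, Finset.mem_univ, true_and, Finset.mem_image, Finset.mem_insert,
      Finset.mem_singleton, exists_eq_or_imp, exists_eq_left]
    constructor
    · intro h
      have : (x - y) * ((x + y) * ((x - i * y) * (x + i * y))) = 0 := by
        have : (x - y) * ((x + y) * ((x - i * y) * (x + i * y)))
          = (x ^ 2 - y ^ 2) * (x ^ 2 - i ^ 2 * y ^ 2) := by ring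
        rw [this, hi]
        linear_combination h
      rcases mul_eq_zero.1 this with h | h
      · left; linear_combination -h
      rcases mul_eq_zero.1 h with h | h
      · right; left; linear_combination -h
      rcases mul_eq_zero.1 h with h | h
      · right; right; left; linear_combination -h
      · right; right; right; linear_combination -h
    · have hi4 : i ^ 4 = 1 := by
        rw [show i ^ 4 = (i ^ 2) ^ 2 by ring, hi]; ring
      rintro (rfl | rfl | rfl | rfl)
      · ring
      · ring
      · rw [mul_pow, hi4, one_mul]
      · rw [mul_pow, neg_pow, hi4]; ring
  rw [hset, Finset.card_image_of_injective _ (mul_left_injective₀ hy)]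
  rw [Finset.card_insert_of_notMem, Finset.card_insert_of_notMem, Finset.card_pair hi3]
  · simp only [Finset.mem_insert, Finset.mem_singleton, not_or]
    refine ⟨hi2.symm, fun h => hi1 ?_⟩
    exact (neg_injective h).symm
  · simp only [Finset.mem_insert, Finset.mem_singleton, not_or]
    refine ⟨hne.symm, hi1.symm, fun h => hi2 ?_⟩
    rw [h, neg_neg]

lemma sum_normSq_powSum_four (hp : p % 8 = 5) :
    ∑ t : ZMod p, Complex.normSq (powSum 4 t) = p * (1 + 4 * (p - 1)) := by
  classical
  have h1 : ∀ t : ZMod p, ((Complex.normSq (powSum 4 t) : ℝ) : ℂ)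
      = ∑ y : ZMod p, ∑ x : ZMod p, ZMod.stdAddChar (t * (x ^ 4 - y ^ 4)) := by
    intro t
    rw [← Complex.mul_conj, conj_powSum, powSum, powSum, Finset.sum_mul_sum, Finset.sum_comm]
    refine Finset.sum_congr rfl fun y _ => Finset.sum_congr rfl fun x _ => ?_
    rw [← AddChar.map_add_eq_mul]
    congr 1; ring
  have h2 : ((∑ t : ZMod p, Complex.normSq (powSum 4 t) : ℝ) : ℂ) =
      ((p * (1 + 4 * (p - 1)) : ℝ) : ℂ) := by
    push_cast
    simp_rw [h1]
    rw [Finset.sum_comm]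
    have h3 : ∀ y : ZMod p, ∑ t : ZMod p, ∑ x : ZMod p, (ZMod.stdAddChar (t * (x ^ 4 - y ^ 4)) : ℂ)
        = (Finset.univ.filter (fun x : ZMod p => x ^ 4 = y ^ 4)).card * (p : ℂ) := by
      intro y
      rw [Finset.sum_comm]
      simp_rw [sum_stdAddChar_mul, sub_eq_zero]
      rw [← Finset.sum_filter, Finset.sum_const, nsmul_eq_mul]
    simp_rw [h3]
    rw [← Finset.sum_mul, ← Finset.add_sum_erase _ _ (Finset.mem_univ (0 : ZMod p))]
    rw [Finset.sum_congr rfl (fun y hy => by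
      rw [card_pow_four_eq hp (Finset.ne_of_mem_erase hy)])]
    rw [Finset.sum_const, Finset.card_erase_of_mem (Finset.mem_univ _), Finset.card_univ, ZMod.card]
    have h4 : Finset.univ.filter (fun x : ZMod p => x ^ 4 = 0 ^ 4) = {0} := by
      ext x; simp
    rw [h4, Finset.card_singleton, nsmul_eq_mul, Nat.cast_sub (Fact.out : p.Prime).one_le]
    push_cast
    ring
  exact_mod_cast h2

lemma sum_im_sq_powSum_four (hp : p % 8 = 5) :
    ∑ t : ZMod p, (powSum 4 t).im ^ 2 = 2 * p * (p - 1) := by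
  classical
  have h := sum_normSq_powSum_four hp
  rw [← Finset.add_sum_erase _ _ (Finset.mem_univ (0 : ZMod p))] at h ⊢
  have h1 : ∀ t ∈ Finset.univ.erase (0 : ZMod p),
      Complex.normSq (powSum 4 t) = p + (powSum 4 t).im ^ 2 := by
    intro t ht
    rw [Complex.normSq_apply, ← sq, ← sq, re_powSum_four_sq hp (Finset.ne_of_mem_erase ht)]
  rw [Finset.sum_congr rfl h1, Finset.sum_add_distrib, Finset.sum_const,
    Finset.card_erase_of_mem (Finset.mem_univ _), Finset.card_univ, ZMod.card, nsmul_eq_mul,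
    Nat.cast_sub (Fact.out : p.Prime).one_le, powSum_zero_right] at h
  rw [powSum_zero_right]
  simp at h ⊢
  linear_combination h

lemma im_sq_powSum_four_le (hp : p % 8 = 5) {t : ZMod p} (ht : t ≠ 0) :
    (powSum 4 t).im ^ 2 ≤ 4 * p := by
  classical
  have hp2 : p ≠ 2 := by rintro rfl; simp at hp
  have hp1 : (1 : ℝ) < p := by exact_mod_cast (Fact.out : p.Prime).one_lt
  have h1 : ((p : ℝ) - 1) * (powSum 4 t).im ^ 2 ≤ ∑ u : ZMod p, (powSum 4 (t * u ^ 2)).im ^ 2 := by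
    rw [← Finset.add_sum_erase _ _ (Finset.mem_univ (0 : ZMod p)),
      Finset.sum_congr rfl (fun u hu => im_sq_powSum_four_mul_sq hp t (Finset.ne_of_mem_erase hu)),
      Finset.sum_const, Finset.card_erase_of_mem (Finset.mem_univ _), Finset.card_univ, ZMod.card,
      nsmul_eq_mul, Nat.cast_sub (Fact.out : p.Prime).one_le]
    push_cast
    linarith [sq_nonneg (powSum 4 (t * 0 ^ 2)).im]
  have h2 := sum_comp_sq hp2 (fun y => (powSum 4 (t * y)).im ^ 2)
  have h3 : ∑ y : ZMod p, (1 + ((quadraticChar (ZMod p) y : ℤ) : ℝ)) * (powSum 4 (t * y)).im ^ 2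
      ≤ ∑ y : ZMod p, 2 * (powSum 4 (t * y)).im ^ 2 := by
    refine Finset.sum_le_sum fun y _ => mul_le_mul_of_nonneg_right ?_ (sq_nonneg _)
    have : (quadraticChar (ZMod p) y : ℤ) ≤ 1 := by
      by_cases hy : y = 0
      · simp [hy]
      · rcases quadraticChar_dichotomy hy with h | h <;> simp [h]
    have : ((quadraticChar (ZMod p) y : ℤ) : ℝ) ≤ 1 := by exact_mod_cast this
    linarith
  rw [← Finset.mul_sum, sum_comp_mul_left (fun y => (powSum 4 y).im ^ 2) ht,
    sum_im_sq_powSum_four hp] at h3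
  have h4 : ((p : ℝ) - 1) * (powSum 4 t).im ^ 2 ≤ ((p : ℝ) - 1) * (4 * p) := by
    rw [h2] at h1
    linarith
  exact le_of_mul_le_mul_left h4 (by linarith)

/-- Zero is under-represented by sums of four biquadrates modulo a prime `p ≡ 5 (mod 8)`. -/
lemma biquadCount_zero_le (hp : p % 8 = 5) :
    (biquadCount p 0 : ℝ) ≤ p ^ 3 - 3 * p * (p - 1) := by
  classical
  have hp1 : (1 : ℝ) < p := by exact_mod_cast (Fact.out : p.Prime).one_lt
  have h := congrArg Complex.re (biquadCount_mul_eq (0 : ZMod p))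
  simp only [mul_zero, neg_zero, AddChar.map_zero_eq_one, one_mul, Complex.re_sum] at h
  rw [← Finset.add_sum_erase _ _ (Finset.mem_univ (0 : ZMod p))] at h
  have h1 : ∀ t ∈ Finset.univ.erase (0 : ZMod p),
      (powSum 4 t ^ 4).re ≤ p ^ 2 - 2 * p * (powSum 4 t).im ^ 2 := by
    intro t ht
    have ht := Finset.ne_of_mem_erase ht
    have e1 := re_powSum_four_sq hp ht
    have e2 := im_sq_powSum_four_le hp ht
    have e3 : (powSum 4 t ^ 4).re = ((powSum 4 t).re ^ 2) ^ 2
        - 6 * (powSum 4 t).re ^ 2 * (powSum 4 t).im ^ 2 + ((powSum 4 t).im ^ 2) ^ 2 := by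
      rw [show powSum 4 t ^ 4 = powSum 4 t * powSum 4 t * (powSum 4 t * powSum 4 t) by ring]
      simp only [Complex.mul_re, Complex.mul_im]
      ring
    rw [e3, e1]
    nlinarith [sq_nonneg (powSum 4 t).im]
  have h2 := Finset.sum_le_sum h1
  have h3 := sum_im_sq_powSum_four hp
  rw [← Finset.add_sum_erase _ _ (Finset.mem_univ (0 : ZMod p)), powSum_zero_right] at h3
  rw [Finset.sum_sub_distrib, ← Finset.mul_sum, Finset.sum_const,
    Finset.card_erase_of_mem (Finset.mem_univ _), Finset.card_univ, ZMod.card, nsmul_eq_mul,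
    Nat.cast_sub (Fact.out : p.Prime).one_le] at h2
  simp only [Complex.natCast_im, ne_eq, OfNat.ofNat_ne_zero, not_false_eq_true, zero_pow,
    zero_add] at h3
  rw [h3] at h2
  rw [powSum_zero_right] at h
  have h4 : ((biquadCount p (0 : ZMod p) : ℂ) * p).re = (biquadCount p (0 : ZMod p) : ℝ) * p := by
    rw [← Nat.cast_mul, Complex.natCast_re]; push_cast; ring
  have h5 : ((p : ℂ) ^ 4).re = (p : ℝ) ^ 4 := by
    rw [← Nat.cast_pow, Complex.natCast_re]; push_cast; ring
  rw [h4, h5] at h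
  push_cast at h2
  have : (biquadCount p (0 : ZMod p) : ℝ) * p ≤ (p ^ 3 - 3 * p * (p - 1)) * p := by
    rw [h]; linarith
  exact le_of_mul_le_mul_right this (by linarith)

lemma norm_sq_powSum_four_le (hp : p % 8 = 5) {t : ZMod p} (ht : t ≠ 0) :
    ‖powSum 4 t‖ ^ 2 ≤ 5 * p := by
  rw [Complex.sq_norm, Complex.normSq_apply, ← sq, ← sq, re_powSum_four_sq hp ht]
  linarith [im_sq_powSum_four_le hp ht]

/-- A uniform upper bound for the number of representations modulo a prime `p ≡ 5 (mod 8)`. -/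
lemma biquadCount_le (hp : p % 8 = 5) (b : ZMod p) :
    (biquadCount p b : ℝ) ≤ p ^ 3 + 100 * (p * √p) := by
  classical
  have hp1 : (1 : ℝ) < p := by exact_mod_cast (Fact.out : p.Prime).one_lt
  have hsq : √(p : ℝ) ^ 2 = p := Real.sq_sqrt (by linarith)
  have hs1 : 1 ≤ √(p : ℝ) := Real.one_le_sqrt.2 hp1.le
  by_cases hb : b = 0
  · subst hb
    have := biquadCount_zero_le hp
    have : 0 ≤ 3 * (p : ℝ) * (p - 1) := by apply mul_nonneg <;> linarith
    have : 0 ≤ 100 * (p * √(p : ℝ)) := by positivity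
    linarith
  have key : ((p : ℂ) - 1) * ((biquadCount p b : ℂ) * p - p ^ 4)
      = ∑ t ∈ Finset.univ.erase (0 : ZMod p), powSum 4 t ^ 4 * (powSum 4 (-(t * b)) - 1) := by
    have h0 : (biquadCount p b : ℂ) * p - p ^ 4 = ∑ t ∈ Finset.univ.erase (0 : ZMod p),
        ZMod.stdAddChar (-(t * b)) * powSum 4 t ^ 4 := by
      rw [biquadCount_mul_eq, ← Finset.add_sum_erase _ _ (Finset.mem_univ (0 : ZMod p)),
        powSum_zero_right]
      simp
    have h1 : ∀ u ∈ Finset.univ.erase (0 : ZMod p), (biquadCount p b : ℂ) * p - p ^ 4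
        = ∑ t ∈ Finset.univ.erase (0 : ZMod p),
        ZMod.stdAddChar (-(t * b) * u ^ 4) * powSum 4 t ^ 4 := by
      intro u hu
      have hu := Finset.ne_of_mem_erase hu
      rw [h0]
      symm
      refine Finset.sum_bij (fun t _ => t * u ^ 4) ?_ ?_ ?_ ?_
      · intro t ht
        simpa [hu] using ht
      · intro s _ t _ h
        exact mul_right_cancel₀ (pow_ne_zero 4 hu) h
      · intro t ht
        refine ⟨t * (u ^ 4)⁻¹, by simpa [hu] using ht, ?_⟩
        field_simp
      · intro t _
        rw [powSum_mul_pow 4 t hu]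
        congr 2
        ring
    have h2 := Finset.sum_congr rfl h1
    rw [Finset.sum_const, Finset.card_erase_of_mem (Finset.mem_univ _), Finset.card_univ,
      ZMod.card, nsmul_eq_mul, Nat.cast_sub (Fact.out : p.Prime).one_le, Nat.cast_one,
      Finset.sum_comm] at h2
    rw [h2]
    refine Finset.sum_congr rfl fun t _ => ?_
    rw [← Finset.sum_mul, mul_comm]
    congr 1
    rw [powSum, ← Finset.add_sum_erase _ _ (Finset.mem_univ (0 : ZMod p))]
    simp
  have h3 : ∀ t ∈ Finset.univ.erase (0 : ZMod p),
      ‖powSum 4 t ^ 4 * (powSum 4 (-(t * b)) - 1)‖ ≤ 100 * (p ^ 2 * √p) := by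
    intro t ht
    have ht := Finset.ne_of_mem_erase ht
    have e1 := norm_sq_powSum_four_le hp ht
    have e2 := norm_sq_powSum_four_le hp (neg_ne_zero.2 (mul_ne_zero ht hb))
    have e3 : ‖powSum 4 (-(t * b))‖ ≤ 3 * √p := by
      refine abs_le_of_sq_le_sq' ?_ (by positivity) |>.2
      rw [mul_pow, hsq]; linarith
    have e4 : ‖powSum 4 (-(t * b)) - 1‖ ≤ 4 * √p := by
      refine (norm_sub_le _ _).trans ?_
      rw [norm_one]; linarith
    rw [norm_mul, norm_pow]
    have e5 : ‖powSum 4 t‖ ^ 4 ≤ 25 * p ^ 2 := by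
      have : (‖powSum 4 t‖ ^ 2) ^ 2 ≤ (5 * (p : ℝ)) ^ 2 := by gcongr
      calc ‖powSum 4 t‖ ^ 4 = (‖powSum 4 t‖ ^ 2) ^ 2 := by ring
        _ ≤ (5 * (p : ℝ)) ^ 2 := this
        _ = 25 * p ^ 2 := by ring
    calc ‖powSum 4 t‖ ^ 4 * ‖powSum 4 (-(t * b)) - 1‖ ≤ (25 * p ^ 2) * (4 * √p) := by gcongr
      _ = 100 * (p ^ 2 * √p) := by ring
  have h4 := norm_sum_le_of_le _ h3
  rw [← key, Finset.sum_const, Finset.card_erase_of_mem (Finset.mem_univ _), Finset.card_univ,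
      ZMod.card, nsmul_eq_mul, Nat.cast_sub (Fact.out : p.Prime).one_le, Nat.cast_one] at h4
  have h5 : ((p : ℂ) - 1) * ((biquadCount p b : ℂ) * p - p ^ 4)
      = ((((p : ℝ) - 1) * ((biquadCount p b : ℝ) * p - p ^ 4) : ℝ) : ℂ) := by push_cast; ring
  rw [h5, Complex.norm_real] at h4
  have h6 := (le_abs_self _).trans h4
  have h7 := le_of_mul_le_mul_left h6 (by linarith)
  have : (biquadCount p b : ℝ) * p ≤ (p ^ 3 + 100 * (p * √p)) * p := by linarith
  exact le_of_mul_le_mul_right this (by linarith)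

end ExpSum

section Dirichlet

open Finset

open ArithmeticFunction vonMangoldt Filter Topology

/-- The sum of the reciprocals of the primes in an invertible residue class diverges. -/
lemma not_summable_one_div_prime_residueClass {q : ℕ} [NeZero q] {a : ZMod q} (ha : IsUnit a) :
    ¬ Summable fun n : ℕ ↦ if n.Prime ∧ (n : ZMod q) = a then (1 : ℝ) / n else 0 := by
  intro hsum
  set g : ℕ → ℝ := fun n ↦ if n.Prime ∧ (n : ZMod q) = a then (1 : ℝ) / n else 0 with hg
  obtain ⟨C, hC⟩ := LSeries_residueClass_lower_bound ha
  set δ : ℕ → ℝ := fun k ↦ 1 / ((k : ℝ) + 1) with hδ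
  have hδpos : ∀ k, 0 < δ k := fun k ↦ by simp only [hδ]; positivity
  have hδle : ∀ k, δ k ≤ 1 := fun k ↦ by
    simp only [hδ]
    rw [div_le_one (by positivity)]
    linarith [(Nat.cast_nonneg k : (0 : ℝ) ≤ k)]
  have hδlim : Tendsto δ atTop (𝓝 0) := tendsto_one_div_add_atTop_nhds_zero_nat
  set w : ℕ → ℕ → ℝ := fun k n ↦
    δ k * ((if n.Prime then residueClass a n else 0) / (n : ℝ) ^ (1 + δ k)) with hw
  have hw0 : ∀ k n, 0 ≤ w k n := fun k n ↦ by
    simp only [hw]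
    refine mul_nonneg (hδpos k).le (div_nonneg ?_ (by positivity))
    split_ifs
    · exact residueClass_nonneg a n
    · exact le_rfl
  have hwg : ∀ k n, w k n ≤ g n := by
    intro k n
    simp only [hw, hg]
    by_cases hn : n.Prime
    · by_cases hna : (n : ZMod q) = a
      · have hn0 : (0 : ℝ) < n := by exact_mod_cast hn.pos
        have hres : residueClass a n = Real.log n := by
          rw [residueClass, Set.indicator_of_mem (by exact hna), vonMangoldt_apply_prime hn]
        rw [if_pos hn, if_pos ⟨hn, hna⟩, hres, Real.rpow_add hn0, Real.rpow_one]
        have h1 := Real.log_le_rpow_div hn0.le (hδpos k)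
        rw [le_div_iff₀ (hδpos k)] at h1
        have h2 : 0 < (n : ℝ) ^ δ k := Real.rpow_pos_of_pos hn0 _
        rw [mul_div_assoc', div_le_div_iff₀ (by positivity) hn0]
        nlinarith
      · simp [hna]
    · simp [hn]
  have hlim : Tendsto (fun k ↦ ∑' n, w k n) atTop (𝓝 (∑' _ : ℕ, (0 : ℝ))) := by
    refine tendsto_tsum_of_dominated_convergence (bound := g) hsum ?_ ?_
    · intro n
      have hb : ∀ k, w k n ≤ δ k * vonMangoldt n := by
        intro k
        simp only [hw]
        refine mul_le_mul_of_nonneg_left ?_ (hδpos k).le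
        rcases Nat.eq_zero_or_pos n with rfl | hn
        · simp
        · have hn1 : (1 : ℝ) ≤ (n : ℝ) ^ (1 + δ k) :=
            Real.one_le_rpow (by exact_mod_cast hn) (by linarith [hδpos k])
          refine (div_le_self ?_ hn1).trans ?_
          · split_ifs
            · exact residueClass_nonneg a n
            · exact le_rfl
          · split_ifs
            · exact residueClass_le a n
            · exact vonMangoldt_nonneg
      refine squeeze_zero (fun k ↦ hw0 k n) hb ?_
      simpa using hδlim.mul_const (vonMangoldt n)
    · filter_upwards with k n
      rw [Real.norm_of_nonneg (hw0 k n)]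
      exact hwg k n
  rw [tsum_zero] at hlim
  have hC2 := summable_residueClass_non_primes_div a
  set C2 := ∑' n : ℕ, (if n.Prime then 0 else residueClass a n) / (n : ℝ) with hC2def
  have hmain : ∀ k, (q.totient : ℝ)⁻¹ - δ k * C ≤ δ k * C2 + ∑' n, w k n := by
    intro k
    have hx : 1 + δ k ∈ Set.Ioc (1 : ℝ) 2 := ⟨by linarith [hδpos k], by linarith [hδle k]⟩
    have h1 := hC hx
    rw [add_sub_cancel_left] at h1
    have hle : ∀ n : ℕ, (if n.Prime then 0 else residueClass a n) / (n : ℝ) ^ (1 + δ k)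
        ≤ (if n.Prime then 0 else residueClass a n) / (n : ℝ) := by
      intro n
      rcases Nat.eq_zero_or_pos n with rfl | hn
      · simp
      · refine div_le_div_of_nonneg_left ?_ (by exact_mod_cast hn) ?_
        · split_ifs
          · exact le_rfl
          · exact residueClass_nonneg a n
        · conv_lhs => rw [← Real.rpow_one n]
          exact Real.rpow_le_rpow_of_exponent_le (by exact_mod_cast hn) (by linarith [hδpos k])
    have hnn : ∀ n : ℕ, 0 ≤ (if n.Prime then 0 else residueClass a n) / (n : ℝ) ^ (1 + δ k) := by
      intro n
      refine div_nonneg ?_ (by positivity)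
      split_ifs
      · exact le_rfl
      · exact residueClass_nonneg a n
    have hs1 : Summable fun n : ℕ ↦
        (if n.Prime then 0 else residueClass a n) / (n : ℝ) ^ (1 + δ k) :=
      Summable.of_nonneg_of_le hnn hle hC2
    have hs2 : Summable (w k) := Summable.of_nonneg_of_le (hw0 k) (hwg k) hsum
    have hs3 : Summable fun n : ℕ ↦
        (if n.Prime then residueClass a n else 0) / (n : ℝ) ^ (1 + δ k) := by
      have := hs2.mul_left (δ k)⁻¹
      refine this.congr fun n ↦ ?_
      simp only [hw]
      rw [inv_mul_cancel_left₀ (hδpos k).ne']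
    have hsplit : ∑' n, residueClass a n / (n : ℝ) ^ (1 + δ k)
        = ∑' n : ℕ, (if n.Prime then 0 else residueClass a n) / (n : ℝ) ^ (1 + δ k)
          + ∑' n : ℕ, (if n.Prime then residueClass a n else 0) / (n : ℝ) ^ (1 + δ k) := by
      rw [← hs1.tsum_add hs3]
      refine tsum_congr fun n ↦ ?_
      split_ifs <;> simp
    have h2 := hs1.tsum_le_tsum hle hC2
    rw [hsplit] at h1
    have h3 : ∑' n, w k n = δ k * ∑' n : ℕ,
        (if n.Prime then residueClass a n else 0) / (n : ℝ) ^ (1 + δ k) := tsum_mul_left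
    rw [h3, ← mul_add]
    have h4 : (q.totient : ℝ)⁻¹ - δ k * C = δ k * ((q.totient : ℝ)⁻¹ / δ k - C) := by
      rw [mul_sub, mul_div_cancel₀ _ (hδpos k).ne']
    rw [h4]
    refine mul_le_mul_of_nonneg_left ?_ (hδpos k).le
    linarith
  have hL : Tendsto (fun k ↦ (q.totient : ℝ)⁻¹ - δ k * C) atTop (𝓝 ((q.totient : ℝ)⁻¹ - 0 * C)) :=
    tendsto_const_nhds.sub (hδlim.mul_const C)
  have hR : Tendsto (fun k ↦ δ k * C2 + ∑' n, w k n) atTop (𝓝 (0 * C2 + 0)) :=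
    (hδlim.mul_const C2).add hlim
  have hfin := le_of_tendsto_of_tendsto' hL hR hmain
  have hq : 0 < (q.totient : ℝ)⁻¹ := inv_pos.mpr (mod_cast q.totient.pos_of_neZero)
  simp only [zero_mul, sub_zero, add_zero] at hfin
  linarith

/-- Outside of any finite set, there are primes `p ≡ 5 (mod 8)` with `∏ (1 - 1 / p)` small. -/
lemma exists_primes_prod_one_sub_inv_le (S : Finset ℕ) {η : ℝ} (hη : 0 < η) :
    ∃ P : Finset ℕ, Disjoint S P ∧ (∀ p ∈ P, p.Prime ∧ p % 8 = 5) ∧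
      ∏ p ∈ P, (1 - 1 / (p : ℝ)) ≤ η := by
  classical
  have ha : IsUnit (5 : ZMod 8) := by decide
  have hns := not_summable_one_div_prime_residueClass ha
  set g : ℕ → ℝ := fun n ↦ if n.Prime ∧ (n : ZMod 8) = 5 then (1 : ℝ) / n else 0 with hg
  have hg0 : 0 ≤ g := fun n ↦ by
    simp only [hg, Pi.zero_apply]
    split_ifs
    · positivity
    · exact le_rfl
  have h1 : ∃ u : Finset ℕ, ∑ n ∈ S, g n - Real.log η < ∑ n ∈ u, g n := by
    by_contra! h
    exact hns (summable_of_sum_le hg0 h)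
  obtain ⟨u, hu⟩ := h1
  refine ⟨(u \ S).filter (fun n : ℕ ↦ n.Prime ∧ (n : ZMod 8) = 5), ?_, ?_, ?_⟩
  · refine Finset.disjoint_left.2 fun x hx hx' ↦ ?_
    exact (Finset.mem_sdiff.1 (Finset.mem_filter.1 hx').1).2 hx
  · intro p hp
    obtain ⟨-, hp1, hp2⟩ := Finset.mem_filter.1 hp
    refine ⟨hp1, ?_⟩
    have : (p : ZMod 8) = ((5 : ℕ) : ZMod 8) := by exact_mod_cast hp2
    exact (ZMod.natCast_eq_natCast_iff' p 5 8).1 this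
  · have h2 : ∑ n ∈ u, g n ≤ ∑ n ∈ u \ S, g n + ∑ n ∈ S, g n := by
      refine (Finset.sum_le_sum_of_subset_of_nonneg (t := (u \ S) ∪ S) ?_ ?_).trans ?_
      · intro x hx
        by_cases hxS : x ∈ S
        · exact Finset.mem_union_right _ hxS
        · exact Finset.mem_union_left _ (Finset.mem_sdiff.2 ⟨hx, hxS⟩)
      · intro i _ _
        exact hg0 i
      · rw [Finset.sum_union Finset.sdiff_disjoint]
    have h3 : ∑ n ∈ u \ S, g n
        = ∑ n ∈ (u \ S).filter (fun n : ℕ ↦ n.Prime ∧ (n : ZMod 8) = 5), 1 / (n : ℝ) := by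
      rw [Finset.sum_filter]
    calc ∏ p ∈ (u \ S).filter (fun n : ℕ ↦ n.Prime ∧ (n : ZMod 8) = 5), (1 - 1 / (p : ℝ))
        ≤ ∏ p ∈ (u \ S).filter (fun n : ℕ ↦ n.Prime ∧ (n : ZMod 8) = 5), Real.exp (-(1 / (p : ℝ))) := by
          refine Finset.prod_le_prod (fun p hp ↦ ?_) (fun p _ ↦ ?_)
          · have : (1 : ℝ) ≤ p := by
              exact_mod_cast (Finset.mem_filter.1 hp).2.1.one_le
            rw [sub_nonneg, div_le_one (by linarith)]
            exact this
          · have := Real.add_one_le_exp (-(1 / (p : ℝ)))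
            linarith
      _ = Real.exp (-∑ n ∈ u \ S, g n) := by
          rw [← Real.exp_sum, h3, Finset.sum_neg_distrib]
      _ ≤ Real.exp (Real.log η) := by
          rw [Real.exp_le_exp]; linarith
      _ = η := Real.exp_log hη

end Dirichlet

section Local

open Finset

lemma biquadCount_mul {m n : ℕ} (h : m.Coprime n) (b : ℕ) :
    biquadCount (m * n) b = biquadCount m b * biquadCount n b := by
  rw [biquadCount, biquadCount, biquadCount, ← Nat.card_prod]
  let e := ZMod.chineseRemainder h
  refine Nat.card_congr (Equiv.trans (Equiv.subtypeEquiv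
    ((Equiv.arrowCongr (Equiv.refl (Fin 4)) e.toEquiv).trans
      (Equiv.arrowProdEquivProdArrow _ _ _)) ?_) Equiv.subtypeProdEquivProd)
  intro x
  have h1 : ∑ i, x i ^ 4 = (b : ZMod (m * n)) ↔ e (∑ i, x i ^ 4) = e b := e.injective.eq_iff.symm
  rw [h1, map_sum, map_natCast, Prod.ext_iff]
  simp only [map_pow, Prod.fst_sum, Prod.snd_sum, Prod.pow_fst, Prod.pow_snd, Prod.fst_natCast,
    Prod.snd_natCast]
  rfl

lemma biquadCount_one (b : ZMod 1) : biquadCount 1 b = 1 := by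
  rw [biquadCount, Nat.card_eq_one_iff_unique]
  refine ⟨⟨fun x y ↦ Subsingleton.elim _ _⟩, ⟨⟨fun _ ↦ 0, Subsingleton.elim _ _⟩⟩⟩

lemma biquadCount_prod {S : Finset ℕ} (hS : ∀ p ∈ S, p.Prime) (b : ℕ) :
    biquadCount (∏ p ∈ S, p) b = ∏ p ∈ S, biquadCount p b := by
  classical
  induction S using Finset.induction_on with
  | empty => simpa using biquadCount_one _
  | insert p S hp ih =>
    rw [Finset.prod_insert hp, Finset.prod_insert hp, biquadCount_mul,
      ih fun q hq ↦ hS q (Finset.mem_insert_of_mem hq)]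
    refine Nat.Coprime.prod_right fun q hq ↦ ?_
    refine (Nat.coprime_primes (hS p (Finset.mem_insert_self _ _))
      (hS q (Finset.mem_insert_of_mem hq))).2 ?_
    rintro rfl
    exact hp hq

/-- An upper bound for `biquadCount p` at primes `p ≡ 5 (mod 8)`. -/
noncomputable def biquadBound (p : ℕ) : ℝ := p ^ 3 + 100 * (p * √p)

lemma exists_residue_prod_biquadCount_le (L : ℕ) {η : ℝ} (hη : 0 < η) :
    ∃ (S : Finset ℕ) (a : ℕ), (∀ p ∈ S, p.Prime ∧ p % 8 = 5) ∧
      ∀ i ∈ Finset.Icc 1 L, (∏ p ∈ S, (biquadCount p ((a + i : ℕ) : ZMod p) : ℝ))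
        ≤ η * ∏ p ∈ S, biquadBound p := by
  classical
  induction L with
  | zero => exact ⟨∅, 0, by simp, by simp⟩
  | succ L ih =>
    obtain ⟨S, a, hS, hSa⟩ := ih
    obtain ⟨P, hSP, hP, hPη⟩ := exists_primes_prod_one_sub_inv_le S hη
    have hcop : (∏ p ∈ S, p).Coprime (∏ p ∈ P, p) := by
      refine Nat.Coprime.prod_left fun p hp ↦ Nat.Coprime.prod_right fun q hq ↦ ?_
      refine (Nat.coprime_primes (hS p hp).1 (hP q hq).1).2 ?_
      rintro rfl
      exact Finset.disjoint_left.1 hSP hp hq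
    have hPpos : 0 < ∏ p ∈ P, p := Finset.prod_pos fun p hp ↦ (hP p hp).1.pos
    obtain ⟨a', ha1, ha2⟩ := Nat.chineseRemainder hcop a ((∏ p ∈ P, p) * (L + 1) - (L + 1))
    have hb0 : ∀ p, 0 ≤ biquadBound p := fun p ↦ by unfold biquadBound; positivity
    have hle : ∀ p, p.Prime ∧ p % 8 = 5 → ∀ b : ZMod p, (biquadCount p b : ℝ) ≤ biquadBound p := by
      rintro p ⟨hp, hp5⟩ b
      have : Fact p.Prime := ⟨hp⟩
      exact biquadCount_le hp5 b
    refine ⟨S ∪ P, a', ?_, ?_⟩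
    · intro p hp
      rcases Finset.mem_union.1 hp with h | h
      exacts [hS p h, hP p h]
    · intro i hi
      obtain ⟨hi1, hi2⟩ := Finset.mem_Icc.1 hi
      rw [Finset.prod_union hSP, Finset.prod_union hSP]
      rcases hi2.lt_or_eq with hlt | rfl
      · have h1 : ∏ p ∈ S, (biquadCount p ((a' + i : ℕ) : ZMod p) : ℝ)
            = ∏ p ∈ S, (biquadCount p ((a + i : ℕ) : ZMod p) : ℝ) := by
          refine Finset.prod_congr rfl fun p hp ↦ ?_
          have : ((a' : ℕ) : ZMod p) = (a : ZMod p) :=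
            (ZMod.natCast_eq_natCast_iff _ _ _).2 (ha1.of_dvd (Finset.dvd_prod_of_mem _ hp))
          push_cast
          rw [this]
        rw [h1, ← mul_assoc]
        refine mul_le_mul (hSa i (Finset.mem_Icc.2 ⟨hi1, by omega⟩)) ?_ ?_ ?_
        · exact Finset.prod_le_prod (fun _ _ ↦ Nat.cast_nonneg _) fun p hp ↦ hle p (hP p hp) _
        · exact Finset.prod_nonneg fun _ _ ↦ Nat.cast_nonneg _
        · exact mul_nonneg hη.le (Finset.prod_nonneg fun _ _ ↦ hb0 _)
      · have h1 : ∏ p ∈ P, (biquadCount p ((a' + (L + 1) : ℕ) : ZMod p) : ℝ)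
            ≤ ∏ p ∈ P, ((1 - 1 / (p : ℝ)) * biquadBound p) := by
          refine Finset.prod_le_prod (fun _ _ ↦ Nat.cast_nonneg _) fun p hp ↦ ?_
          obtain ⟨hpp, hp5⟩ := hP p hp
          have : Fact p.Prime := ⟨hpp⟩
          have hp1 : (5 : ℝ) ≤ p := by
            have : 5 ≤ p := by omega
            exact_mod_cast this
          have hz : ((a' + (L + 1) : ℕ) : ZMod p) = 0 := by
            rw [ZMod.natCast_eq_zero_iff]
            have h2 : a' + (L + 1) ≡ (∏ p ∈ P, p) * (L + 1) - (L + 1) + (L + 1) [MOD ∏ p ∈ P, p] :=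
              ha2.add_right _
            rw [Nat.sub_add_cancel (Nat.le_mul_of_pos_left _ hPpos)] at h2
            have h3 := h2.of_dvd (Finset.dvd_prod_of_mem (fun p ↦ p) hp)
            exact (h3.dvd_iff dvd_rfl).2
              (Dvd.dvd.mul_right (Finset.dvd_prod_of_mem (fun p ↦ p) hp) _)
          rw [hz]
          refine (biquadCount_zero_le hp5).trans ?_
          have h4 : (0 : ℝ) ≤ 1 - 1 / p := by
            rw [sub_nonneg, div_le_one (by linarith)]; linarith
          refine le_trans ?_ (mul_le_mul_of_nonneg_left
            (show (p : ℝ) ^ 3 ≤ biquadBound p by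
              unfold biquadBound
              have : 0 ≤ 100 * (p * √(p : ℝ)) := by positivity
              linarith) h4)
          have h5 : (1 - 1 / (p : ℝ)) * p ^ 3 = p ^ 3 - p ^ 2 := by field_simp
          rw [h5]
          nlinarith
        rw [Finset.prod_mul_distrib] at h1
        have h2 : ∏ p ∈ P, (biquadCount p ((a' + (L + 1) : ℕ) : ZMod p) : ℝ)
            ≤ η * ∏ p ∈ P, biquadBound p :=
          h1.trans (mul_le_mul_of_nonneg_right hPη (Finset.prod_nonneg fun _ _ ↦ hb0 _))
        calc _ ≤ (∏ p ∈ S, biquadBound p) * (η * ∏ p ∈ P, biquadBound p) := by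
              refine mul_le_mul ?_ h2 (Finset.prod_nonneg fun _ _ ↦ Nat.cast_nonneg _)
                (Finset.prod_nonneg fun _ _ ↦ hb0 _)
              exact Finset.prod_le_prod (fun _ _ ↦ Nat.cast_nonneg _) fun p hp ↦ hle p (hS p hp) _
          _ = _ := by ring

lemma exists_prod_biquadBound_le :
    ∃ D : ℝ, 0 < D ∧ ∀ S : Finset ℕ, (∀ p ∈ S, p.Prime) →
      ∏ p ∈ S, biquadBound p ≤ D * ((∏ p ∈ S, p : ℕ) : ℝ) ^ 3 := by
  have hs : Summable fun n : ℕ ↦ 1 / (n : ℝ) ^ (3 / 2 : ℝ) :=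
    Real.summable_one_div_nat_rpow.2 (by norm_num)
  refine ⟨Real.exp (100 * ∑' n : ℕ, 1 / (n : ℝ) ^ (3 / 2 : ℝ)), Real.exp_pos _, fun S hS ↦ ?_⟩
  have h1 : ∏ p ∈ S, biquadBound p
      ≤ ∏ p ∈ S, (Real.exp (100 * (1 / (p : ℝ) ^ (3 / 2 : ℝ))) * (p : ℝ) ^ 3) := by
    refine Finset.prod_le_prod (fun p _ ↦ by unfold biquadBound; positivity) fun p hp ↦ ?_
    have hp0 : (0 : ℝ) < p := by exact_mod_cast (hS p hp).pos
    have h2 := Real.add_one_le_exp (100 * (1 / (p : ℝ) ^ (3 / 2 : ℝ)))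
    refine le_trans (le_of_eq ?_) (mul_le_mul_of_nonneg_right h2 (by positivity))
    have h3 : (p : ℝ) ^ (3 / 2 : ℝ) = p * √p := by
      rw [Real.sqrt_eq_rpow, ← Real.rpow_one_add' hp0.le (by norm_num)]
      norm_num
    have h4 : √(p : ℝ) ^ 2 = p := Real.sq_sqrt hp0.le
    have h5 : 0 < √(p : ℝ) := Real.sqrt_pos.2 hp0
    rw [h3, biquadBound]
    field_simp
    linear_combination 100 * h4
  refine h1.trans ?_
  rw [Finset.prod_mul_distrib, ← Real.exp_sum, ← Finset.mul_sum, Finset.prod_pow]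
  push_cast
  refine mul_le_mul_of_nonneg_right ?_ (by positivity)
  rw [Real.exp_le_exp]
  refine mul_le_mul_of_nonneg_left ?_ (by norm_num)
  exact hs.sum_le_tsum S fun _ _ ↦ by positivity

/-- There are arithmetic progressions along which many consecutive integers have arbitrarily few
representations as sums of four biquadrates. -/
lemma exists_modulus_biquadCount_le :
    ∃ D : ℝ, 0 < D ∧ ∀ (L : ℕ) (η : ℝ), 0 < η → ∃ M a : ℕ, 0 < M ∧
      (∀ b : ℕ, (biquadCount M b : ℝ) ≤ D * M ^ 3) ∧
      ∀ i ∈ Finset.Icc 1 L, (biquadCount M ((a + i : ℕ) : ZMod M) : ℝ) ≤ η * M ^ 3 := by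
  obtain ⟨D, hD, hDS⟩ := exists_prod_biquadBound_le
  refine ⟨D, hD, fun L η hη ↦ ?_⟩
  obtain ⟨S, a, hS, ha⟩ := exists_residue_prod_biquadCount_le L (div_pos hη hD)
  have hS' : ∀ p ∈ S, p.Prime := fun p hp ↦ (hS p hp).1
  refine ⟨∏ p ∈ S, p, a, Finset.prod_pos fun p hp ↦ (hS' p hp).pos, fun b ↦ ?_, fun i hi ↦ ?_⟩
  · rw [biquadCount_prod hS', Nat.cast_prod]
    refine le_trans ?_ (hDS S hS')
    refine Finset.prod_le_prod (fun _ _ ↦ Nat.cast_nonneg _) fun p hp ↦ ?_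
    have : Fact p.Prime := ⟨hS' p hp⟩
    exact biquadCount_le (hS p hp).2 _
  · rw [biquadCount_prod hS', Nat.cast_prod]
    refine (ha i hi).trans ?_
    calc η / D * ∏ p ∈ S, biquadBound p ≤ η / D * (D * ((∏ p ∈ S, p : ℕ) : ℝ) ^ 3) :=
          mul_le_mul_of_nonneg_left (hDS S hS') (div_pos hη hD).le
      _ = _ := by field_simp

end Local

section Representations

open Finset

open Classical in
/-- The number of representations of `n` as an ordered sum of `k` biquadrates. -/
noncomputable def biquadRep : ℕ → ℕ → ℕ
  | 0, n => if n = 0 then 1 else 0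
  | k + 1, n => ∑ p ∈ antidiagonal n, (if ∃ m, m ^ 4 = p.1 then 1 else 0) * biquadRep k p.2

lemma biquadRep_le_add_pow (k n m : ℕ) : biquadRep k n ≤ biquadRep (k + 1) (n + m ^ 4) := by
  classical
  rw [biquadRep]
  refine le_trans ?_ (Finset.single_le_sum (fun _ _ ↦ Nat.zero_le _)
    (show (m ^ 4, n) ∈ antidiagonal (n + m ^ 4) by rw [HasAntidiagonal.mem_antidiagonal, add_comm]))
  rw [if_pos ⟨m, rfl⟩, one_mul]

lemma biquadRep_mono {k l : ℕ} (h : k ≤ l) (n : ℕ) : biquadRep k n ≤ biquadRep l n := by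
  induction l, h using Nat.le_induction with
  | base => exact le_rfl
  | succ l _ ih => exact ih.trans (by simpa using biquadRep_le_add_pow l n 0)

lemma sum_biquadRep_mul_le (k : ℕ) {Y Z : ℕ} (hYZ : Y ≤ Z ^ 4) (ψ : ℕ → ℕ) :
    ∑ n ∈ range Y, biquadRep k n * ψ n
      ≤ ∑ x ∈ Fintype.piFinset (fun _ : Fin k ↦ range Z), ψ (∑ i, x i ^ 4) := by
  classical
  induction k generalizing ψ with
  | zero =>
    simp only [biquadRep, ite_mul, one_mul, zero_mul, Finset.sum_ite_eq', mem_range]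
    split_ifs <;> simp
  | succ k ih =>
    have h1 : ∑ n ∈ range Y, biquadRep (k + 1) n * ψ n
        ≤ ∑ i ∈ range Y, ∑ j ∈ range Y,
          (if ∃ m, m ^ 4 = i then 1 else 0) * (biquadRep k j * ψ (i + j)) := by
      simp_rw [biquadRep, Finset.sum_mul]
      rw [Finset.sum_sigma', ← Finset.sum_product']
      refine le_trans (le_of_eq ?_) (Finset.sum_le_sum_of_subset
        (s := (range Y ×ˢ range Y).filter (fun p ↦ p.1 + p.2 < Y)) (Finset.filter_subset _ _))
      refine Finset.sum_bij (fun x _ ↦ x.2) ?_ ?_ ?_ ?_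
      · rintro ⟨n, i, j⟩ h
        simp only [mem_sigma, mem_range, HasAntidiagonal.mem_antidiagonal, mem_filter, mem_product] at h ⊢
        omega
      · rintro ⟨n, i, j⟩ h ⟨n', i', j'⟩ h' e
        simp only [mem_sigma, mem_range, HasAntidiagonal.mem_antidiagonal] at h h'
        obtain ⟨-, rfl⟩ := h
        obtain ⟨-, rfl⟩ := h'
        simp only [Prod.mk.injEq] at e
        obtain ⟨rfl, rfl⟩ := e
        rfl
      · rintro ⟨i, j⟩ h
        simp only [mem_filter, mem_product, mem_range] at h
        refine ⟨⟨i + j, i, j⟩, ?_, rfl⟩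
        simp only [mem_sigma, mem_range, HasAntidiagonal.mem_antidiagonal, and_true]
        omega
      · rintro ⟨n, i, j⟩ h
        simp only [mem_sigma, mem_range, HasAntidiagonal.mem_antidiagonal] at h
        simp only [h.2, mul_assoc]
    have h2 : ∀ i : ℕ, ∑ j ∈ range Y,
          (if ∃ m, m ^ 4 = i then 1 else 0) * (biquadRep k j * ψ (i + j))
        ≤ (if ∃ m, m ^ 4 = i then 1 else 0) *
          ∑ x ∈ Fintype.piFinset (fun _ : Fin k ↦ range Z), ψ (i + ∑ l, x l ^ 4) := by
      intro i
      rw [← Finset.mul_sum]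
      exact Nat.mul_le_mul_left _ (ih fun n ↦ ψ (i + n))
    refine h1.trans ((Finset.sum_le_sum fun i _ ↦ h2 i).trans ?_)
    have h3 : ∑ i ∈ range Y, (if ∃ m, m ^ 4 = i then 1 else 0) *
          ∑ x ∈ Fintype.piFinset (fun _ : Fin k ↦ range Z), ψ (i + ∑ l, x l ^ 4)
        ≤ ∑ m ∈ range Z, ∑ x ∈ Fintype.piFinset (fun _ : Fin k ↦ range Z),
            ψ (m ^ 4 + ∑ l, x l ^ 4) := by
      have hinj : Function.Injective (fun m : ℕ ↦ m ^ 4) :=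
        Nat.pow_left_injective (by norm_num)
      rw [← Finset.sum_image (f := fun i ↦
        ∑ x ∈ Fintype.piFinset (fun _ : Fin k ↦ range Z), ψ (i + ∑ l, x l ^ 4))
        (g := fun m : ℕ ↦ m ^ 4) (s := range Z) (fun _ _ _ _ h ↦ hinj h)]
      simp only [ite_mul, one_mul, zero_mul]
      rw [← Finset.sum_filter]
      refine Finset.sum_le_sum_of_subset fun i hi ↦ ?_
      simp only [mem_filter, mem_range, mem_image] at hi ⊢
      obtain ⟨hi, m, rfl⟩ := hi
      exact ⟨m, lt_of_pow_lt_pow_left₀ 4 (Nat.zero_le _) (hi.trans_le hYZ), rfl⟩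
    refine h3.trans (le_of_eq ?_)
    rw [← Finset.sum_product']
    refine Finset.sum_bij (fun p _ ↦ (Fin.cons p.1 p.2 : Fin (k + 1) → ℕ)) ?_ ?_ ?_ ?_
    · rintro ⟨m, x⟩ h
      simp only [mem_product, mem_range, Fintype.mem_piFinset] at h ⊢
      intro i
      refine Fin.cases ?_ (fun j ↦ ?_) i
      · simpa using h.1
      · simpa using h.2 j
    · rintro ⟨m, x⟩ _ ⟨m', x'⟩ _ h
      obtain ⟨h1, h2⟩ := Fin.cons_injective2 h
      exact Prod.ext h1 h2
    · intro x hx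
      simp only [Fintype.mem_piFinset, mem_range] at hx
      refine ⟨(x 0, Fin.tail x), ?_, Fin.cons_self_tail x⟩
      simp only [mem_product, mem_range, Fintype.mem_piFinset]
      exact ⟨hx 0, fun i ↦ hx i.succ⟩
    · rintro ⟨m, x⟩ _
      simp [Fin.sum_univ_succ]

lemma sum_biquadRep_le (k : ℕ) {Y Z : ℕ} (hYZ : Y ≤ Z ^ 4) :
    ∑ n ∈ range Y, biquadRep k n ≤ Z ^ k := by
  have := sum_biquadRep_mul_le k hYZ fun _ ↦ 1
  simpa using this

lemma biquadRep_le (k n : ℕ) : biquadRep k n ≤ (n + 1) ^ k := by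
  refine le_trans ?_ (sum_biquadRep_le k (Nat.le_self_pow (by norm_num) (n + 1)))
  exact Finset.single_le_sum (f := fun n ↦ biquadRep k n) (fun _ _ ↦ Nat.zero_le _)
    (Finset.self_mem_range_succ n)

lemma card_filter_range_cast_eq_le (Z : ℕ) {M : ℕ} (y : ZMod M) :
    ((range Z).filter (fun x : ℕ ↦ (x : ZMod M) = y)).card ≤ Z / M + 1 := by
  have h1 : ((range Z).filter (fun x : ℕ ↦ (x : ZMod M) = y)).card ≤ (range (Z / M + 1)).card := by
    refine Finset.card_le_card_of_injOn (fun x ↦ x / M) ?_ ?_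
    · intro x hx
      simp only [coe_filter, mem_range, Set.mem_ofPred_eq] at hx
      simp only [coe_range, Set.mem_Iio]
      exact Nat.lt_succ_of_le (Nat.div_le_div_right hx.1.le)
    · intro x hx x' hx' h
      simp only [coe_filter, mem_range, Set.mem_ofPred_eq] at hx hx'
      have h2 : x % M = x' % M :=
        (ZMod.natCast_eq_natCast_iff' _ _ _).1 (hx.2.trans hx'.2.symm)
      simp only [] at h
      rw [← Nat.div_add_mod x M, ← Nat.div_add_mod x' M, h, h2]
  simpa using h1

lemma sum_biquadRep_four_modEq_le {Y Z M : ℕ} (hM : 0 < M) (hYZ : Y ≤ Z ^ 4) (b : ZMod M) :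
    ∑ n ∈ (range Y).filter (fun n : ℕ ↦ (n : ZMod M) = b), biquadRep 4 n
      ≤ biquadCount M b * (Z / M + 1) ^ 4 := by
  classical
  have : NeZero M := ⟨hM.ne'⟩
  have h1 := sum_biquadRep_mul_le 4 hYZ fun n ↦ if (n : ZMod M) = b then 1 else 0
  simp only [mul_ite, mul_one, mul_zero] at h1
  rw [← Finset.sum_filter] at h1
  refine h1.trans ?_
  rw [← Finset.card_filter, biquadCount, Nat.card_eq_fintype_card, Fintype.card_subtype, mul_comm]
  refine Finset.card_le_mul_card_image_of_maps_to
    (f := fun (x : Fin 4 → ℕ) (i : Fin 4) ↦ ((x i : ℕ) : ZMod M)) ?_ _ ?_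
  · intro x hx
    simp only [mem_filter, mem_univ, true_and] at hx ⊢
    exact_mod_cast hx.2
  · intro y _
    have h2 : (((Fintype.piFinset fun _ : Fin 4 ↦ range Z).filter
          (fun x ↦ ((∑ i, x i ^ 4 : ℕ) : ZMod M) = b)).filter
          (fun x ↦ (fun i ↦ ((x i : ℕ) : ZMod M)) = y))
        ⊆ Fintype.piFinset fun i : Fin 4 ↦ (range Z).filter (fun x : ℕ ↦ (x : ZMod M) = y i) := by
      intro x hx
      simp only [mem_filter, Fintype.mem_piFinset] at hx ⊢
      exact fun i ↦ ⟨hx.1.1 i, congrFun hx.2 i⟩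
    refine (Finset.card_le_card h2).trans ?_
    rw [Fintype.card_piFinset]
    refine (Finset.prod_le_pow_card _ _ _ fun i _ ↦ card_filter_range_cast_eq_le Z (y i)).trans ?_
    simp

lemma summable_biquadRep_mul_pow (k : ℕ) {z : ℝ} (hz0 : 0 ≤ z) (hz1 : z < 1) :
    Summable fun n ↦ (biquadRep k n : ℝ) * z ^ n := by
  have h1 : Summable fun n : ℕ ↦ ((n : ℝ) + 1) ^ k * z ^ n := by
    rcases hz0.eq_or_lt with rfl | hz
    · refine summable_of_ne_finset_zero (s := {0}) fun n hn ↦ ?_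
      rw [zero_pow (by simpa using hn), mul_zero]
    · have h := (summable_nat_add_iff 1).2
        (summable_pow_mul_geometric_of_norm_lt_one k (r := z) (by rwa [Real.norm_of_nonneg hz0]))
      refine (h.mul_left z⁻¹).congr fun n ↦ ?_
      push_cast
      rw [pow_succ]
      field_simp
  refine Summable.of_nonneg_of_le (fun n ↦ by positivity) (fun n ↦ ?_) h1
  refine mul_le_mul_of_nonneg_right ?_ (by positivity)
  exact_mod_cast biquadRep_le k n

lemma tsum_biquadRep_mul_pow (k : ℕ) {z : ℝ} (hz0 : 0 ≤ z) (hz1 : z < 1) :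
    ∑' n, (biquadRep k n : ℝ) * z ^ n = (∑' n : ℕ, z ^ n ^ 4) ^ k := by
  classical
  induction k with
  | zero =>
    rw [tsum_eq_single 0 fun n hn ↦ by simp [biquadRep, hn]]
    simp [biquadRep]
  | succ k ih =>
    set f : ℕ → ℝ := fun n ↦ (if ∃ m, m ^ 4 = n then 1 else 0) * z ^ n with hf
    have hinj : Function.Injective (fun m : ℕ ↦ m ^ 4) :=
      Nat.pow_left_injective (by norm_num)
    have h1 : ∑' n, f n = ∑' n : ℕ, z ^ n ^ 4 := by
      rw [← hinj.tsum_eq]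
      · exact tsum_congr fun m ↦ by simp [hf]
      · intro n hn
        by_contra h
        refine hn ?_
        simp only [hf]
        rw [if_neg (by simpa using h), zero_mul]
    have hf0 : ∀ n, 0 ≤ f n := fun n ↦ by simp only [hf]; positivity
    have h2 : Summable f := by
      refine Summable.of_nonneg_of_le hf0 (fun n ↦ ?_) (summable_geometric_of_lt_one hz0 hz1)
      simp only [hf]
      split_ifs <;> simp [pow_nonneg hz0]
    have h3 := summable_biquadRep_mul_pow k hz0 hz1
    rw [pow_succ', ← ih, ← h1,
      tsum_mul_tsum_eq_tsum_sum_antidiagonal_of_summable_norm h2.norm h3.norm]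
    refine tsum_congr fun n ↦ ?_
    rw [biquadRep]
    push_cast
    rw [Finset.sum_mul]
    refine Finset.sum_congr rfl fun p hp ↦ ?_
    rw [← HasAntidiagonal.mem_antidiagonal.1 hp, pow_add]
    simp only [hf]
    split_ifs <;> ring

end Representations

section Tails

open Finset

/-- The tail `∑_{i ≥ 0} c (N + 1 + i) z ^ (i + 1)` of a power series, normalised at `N`. -/
noncomputable def shiftedTail (z : ℝ) (c : ℕ → ℝ) (N : ℕ) : ℝ :=
  ∑' i : ℕ, c (N + 1 + i) * z ^ (i + 1)

lemma summable_shiftedTail {z : ℝ} {c : ℕ → ℝ} (hc : Summable fun n ↦ c n * z ^ n) (N : ℕ) :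
    Summable fun i ↦ c (N + 1 + i) * z ^ (i + 1) := by
  rcases eq_or_ne z 0 with rfl | hz
  · exact summable_zero.congr fun i ↦ by simp
  · refine (((summable_nat_add_iff (N + 1)).2 hc).mul_left ((z ^ N)⁻¹)).congr fun i ↦ ?_
    rw [show N + 1 + i = i + (N + 1) by ring, show z ^ (i + (N + 1)) = z ^ N * z ^ (i + 1) by ring]
    have := pow_ne_zero N hz
    field_simp

lemma exists_int_eq_shiftedTail {q : ℕ} (hq : 0 < q) {c : ℕ → ℤ}
    (hc : Summable fun n ↦ (c n : ℝ) * (1 / (q : ℝ)) ^ n)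
    (h0 : ∑' n, (c n : ℝ) * (1 / (q : ℝ)) ^ n = 0) (N : ℕ) :
    ∃ t : ℤ, (t : ℝ) = shiftedTail (1 / (q : ℝ)) (fun n ↦ (c n : ℝ)) N := by
  have hq' : (q : ℝ) ≠ 0 := by exact_mod_cast hq.ne'
  have h1 := hc.sum_add_tsum_nat_add (N + 1)
  rw [h0] at h1
  refine ⟨-∑ n ∈ range (N + 1), c n * (q : ℤ) ^ (N - n), ?_⟩
  have h2 : shiftedTail (1 / (q : ℝ)) (fun n ↦ (c n : ℝ)) N
      = (q : ℝ) ^ N * ∑' i, (c (i + (N + 1)) : ℝ) * (1 / (q : ℝ)) ^ (i + (N + 1)) := by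
    rw [← tsum_mul_left]
    refine tsum_congr fun i ↦ ?_
    rw [show N + 1 + i = i + (N + 1) by ring,
      show i + (N + 1) = N + (i + 1) by ring, pow_add _ N, one_div, inv_pow _ N]
    field_simp
  have h3 : (q : ℝ) ^ N * ∑ n ∈ range (N + 1), (c n : ℝ) * (1 / (q : ℝ)) ^ n
      = ∑ n ∈ range (N + 1), (c n : ℝ) * (q : ℝ) ^ (N - n) := by
    rw [Finset.mul_sum]
    refine Finset.sum_congr rfl fun n hn ↦ ?_
    rw [← pow_sub_mul_pow (q : ℝ) (Nat.lt_succ_iff.1 (mem_range.1 hn)), one_div, inv_pow]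
    field_simp
  rw [h2, eq_neg_of_add_eq_zero_right h1, mul_neg, h3]
  push_cast
  rfl

/-- The constant `∑_{j ≥ 0} (1 + j) ^ 4 / 2 ^ j`. -/
noncomputable def quarticHalfSum : ℝ := ∑' j : ℕ, (1 + (j : ℝ)) ^ 4 * (1 / 2) ^ j

lemma summable_quartic_half : Summable fun j : ℕ ↦ (1 + (j : ℝ)) ^ 4 * (1 / 2 : ℝ) ^ j := by
  have h := (summable_nat_add_iff 1).2 (summable_pow_mul_geometric_of_norm_lt_one 4
    (r := (1 / 2 : ℝ)) (by norm_num))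
  refine (h.mul_left 2).congr fun n ↦ ?_
  push_cast
  ring

lemma quarticHalfSum_nonneg : 0 ≤ quarticHalfSum := tsum_nonneg fun _ ↦ by positivity

lemma shiftedTail_pos {z A : ℝ} (hz0 : 0 < z) (hz : z ≤ 1 / 2) (hA : 0 ≤ A) {c : ℕ → ℝ}
    (hc : Summable fun n ↦ c n * z ^ n) (hlow : ∀ n : ℕ, -(A * ((n : ℝ) + 1) ^ 3) ≤ c n)
    {N n₀ K : ℕ} (hN : N < n₀) (h1 : 1 ≤ c n₀) (hK : ∀ n, N < n → n ≤ n₀ + K → 0 ≤ c n)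
    (hsmall : A * ((n₀ : ℝ) + 1) ^ 3 * ((K : ℝ) + 2) ^ 3 * quarticHalfSum < 2 ^ (K + 1)) :
    0 < shiftedTail z c N := by
  obtain ⟨d, rfl⟩ : ∃ d, n₀ = N + 1 + d := ⟨n₀ - N - 1, by omega⟩
  set n₀ := N + 1 + d with hn₀
  have hs := summable_shiftedTail hc N
  rw [shiftedTail, ← hs.sum_add_tsum_nat_add (d + K + 1)]
  have h2 : z ^ (d + 1) ≤ ∑ i ∈ range (d + K + 1), c (N + 1 + i) * z ^ (i + 1) := by
    refine le_trans ?_ (Finset.single_le_sum (f := fun i ↦ c (N + 1 + i) * z ^ (i + 1))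
      (fun i hi ↦ ?_) (show d ∈ range (d + K + 1) from mem_range.2 (by omega)))
    · simpa using mul_le_mul_of_nonneg_right h1 (pow_nonneg hz0.le (d + 1))
    · have := mem_range.1 hi
      exact mul_nonneg (hK _ (by omega) (by omega)) (by positivity)
  set κ : ℝ := z ^ (d + 1) * (A * ((n₀ : ℝ) + 1) ^ 3 * ((K : ℝ) + 2) ^ 3 * (1 / 2) ^ (K + 1)) with hκ
  have h3 : -(κ * quarticHalfSum)
      ≤ ∑' i, c (N + 1 + (i + (d + K + 1))) * z ^ (i + (d + K + 1) + 1) := by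
    rw [← neg_mul, quarticHalfSum, ← tsum_mul_left]
    have hs' : Summable fun i ↦ c (N + 1 + (i + (d + K + 1))) * z ^ (i + (d + K + 1) + 1) :=
      (summable_nat_add_iff (f := fun i ↦ c (N + 1 + i) * z ^ (i + 1)) (d + K + 1)).2 hs
    refine Summable.tsum_le_tsum (fun i ↦ ?_) (summable_quartic_half.mul_left _) hs'
    have e1 : z ^ (i + (d + K + 1) + 1) = z ^ (d + 1) * (z ^ (K + 1) * z ^ i) := by ring
    have e2 : N + 1 + (i + (d + K + 1)) = n₀ + K + 1 + i := by omega
    rw [e1, e2]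
    have h4 := hlow (n₀ + K + 1 + i)
    have h5 : z ^ (K + 1) * z ^ i ≤ (1 / 2) ^ (K + 1) * (1 / 2) ^ i := by gcongr
    have h6 : (((n₀ + K + 1 + i : ℕ) : ℝ) + 1) ^ 3
        ≤ ((n₀ : ℝ) + 1) ^ 3 * ((K : ℝ) + 2) ^ 3 * (1 + (i : ℝ)) ^ 4 := by
      have h7 : ((n₀ + K + 1 + i : ℕ) : ℝ) + 1 ≤ ((n₀ : ℝ) + 1) * (K + 2) * (1 + i) := by
        have a : (0 : ℝ) ≤ n₀ := by positivity
        have b : (0 : ℝ) ≤ K := by positivity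
        have c : (0 : ℝ) ≤ i := by positivity
        push_cast
        nlinarith [mul_nonneg a b, mul_nonneg a c, mul_nonneg b c,
          mul_nonneg (mul_nonneg a b) c]
      calc (((n₀ + K + 1 + i : ℕ) : ℝ) + 1) ^ 3 ≤ (((n₀ : ℝ) + 1) * (K + 2) * (1 + i)) ^ 3 := by
            gcongr
        _ = ((n₀ : ℝ) + 1) ^ 3 * ((K : ℝ) + 2) ^ 3 * (1 + (i : ℝ)) ^ 3 := by ring
        _ ≤ _ := by
            gcongr
            · exact le_add_of_nonneg_right (by positivity)
            · norm_num
    have h7 : -(A * (((n₀ : ℝ) + 1) ^ 3 * ((K : ℝ) + 2) ^ 3 * (1 + (i : ℝ)) ^ 4))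
        ≤ c (n₀ + K + 1 + i) := le_trans (neg_le_neg (mul_le_mul_of_nonneg_left h6 hA)) h4
    have h8 : A * (((n₀ : ℝ) + 1) ^ 3 * ((K : ℝ) + 2) ^ 3 * (1 + (i : ℝ)) ^ 4)
        * (z ^ (d + 1) * (z ^ (K + 1) * z ^ i))
        ≤ A * (((n₀ : ℝ) + 1) ^ 3 * ((K : ℝ) + 2) ^ 3 * (1 + (i : ℝ)) ^ 4)
        * (z ^ (d + 1) * ((1 / 2) ^ (K + 1) * (1 / 2) ^ i)) := by gcongr
    have h9 := mul_le_mul_of_nonneg_right h7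
      (show 0 ≤ z ^ (d + 1) * (z ^ (K + 1) * z ^ i) by positivity)
    rw [hκ]
    linarith
  have h4 : κ * quarticHalfSum < z ^ (d + 1) := by
    have h5 : κ * quarticHalfSum = z ^ (d + 1) *
        ((A * ((n₀ : ℝ) + 1) ^ 3 * ((K : ℝ) + 2) ^ 3 * quarticHalfSum) / 2 ^ (K + 1)) := by
      rw [hκ, one_div, inv_pow]
      ring
    rw [h5]
    exact mul_lt_of_lt_one_right (by positivity) ((div_lt_one (by positivity)).2 hsmall)
  linarith

lemma shiftedTail_mono {z : ℝ} (hz : 0 ≤ z) {c e : ℕ → ℝ} (hc : Summable fun n ↦ c n * z ^ n)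
    (he : Summable fun n ↦ e n * z ^ n) (h : ∀ n, c n ≤ e n) (N : ℕ) :
    shiftedTail z c N ≤ shiftedTail z e N :=
  Summable.tsum_le_tsum (fun i ↦ mul_le_mul_of_nonneg_right (h _) (by positivity))
    (summable_shiftedTail hc N) (summable_shiftedTail he N)

lemma sum_shiftedTail_le {z : ℝ} (hz0 : 0 ≤ z) (hz : z ≤ 1 / 2) {c G : ℕ → ℝ}
    (hc : Summable fun n ↦ c n * z ^ n) (hG0 : ∀ i, 0 ≤ G i) {S : Finset ℕ}
    (hG : Summable fun i ↦ G i * (1 / 2) ^ i) (h : ∀ i, ∑ N ∈ S, c (N + 1 + i) ≤ G i) :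
    ∑ N ∈ S, shiftedTail z c N ≤ ∑' i, G i * (1 / 2) ^ i := by
  simp only [shiftedTail]
  rw [← Summable.tsum_finsetSum fun N _ ↦ summable_shiftedTail hc N]
  refine Summable.tsum_le_tsum (fun i ↦ ?_)
    (summable_sum fun N _ ↦ summable_shiftedTail hc N) hG
  rw [← Finset.sum_mul]
  refine (mul_le_mul_of_nonneg_right (h i) (by positivity)).trans ?_
  refine mul_le_mul_of_nonneg_left ?_ (hG0 i)
  calc z ^ (i + 1) ≤ (1 / 2) ^ (i + 1) := by gcongr
    _ ≤ (1 / 2) ^ i := pow_le_pow_of_le_one (by norm_num) (by norm_num) (Nat.le_succ i)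

lemma pow_four_add_le (Z i : ℕ) : Z ^ 4 + (1 + i) ≤ (Z + 1 + i) ^ 4 := by
  have h : 1 + i ≤ (1 + i) ^ 4 := Nat.le_self_pow (by norm_num) _
  have h2 : Z ^ 4 + (1 + i) ^ 4 ≤ (Z + (1 + i)) ^ 4 := pow_add_pow_le (Nat.zero_le _) (Nat.zero_le _) (by norm_num)
  rw [add_assoc]
  omega

lemma sum_shiftedTail_biquadRep_three_le {z : ℝ} (hz0 : 0 ≤ z) (hz : z ≤ 1 / 2) (Z : ℕ)
    {S : Finset ℕ} (hS : S ⊆ range (Z ^ 4)) :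
    ∑ N ∈ S, shiftedTail z (fun n ↦ (biquadRep 3 n : ℝ)) N
      ≤ ((Z : ℝ) + 1) ^ 3 * quarticHalfSum := by
  have h1 : ∀ i : ℕ, ∑ N ∈ S, (biquadRep 3 (N + 1 + i) : ℝ)
      ≤ ((Z : ℝ) + 1) ^ 3 * (1 + (i : ℝ)) ^ 4 := by
    intro i
    have h2 : ∑ N ∈ S, biquadRep 3 (N + 1 + i) ≤ (Z + 1 + i) ^ 3 := by
      refine le_trans ?_ (sum_biquadRep_le 3 (pow_four_add_le Z i))
      rw [← Finset.sum_image (f := fun n ↦ biquadRep 3 n) (g := fun N ↦ N + 1 + i)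
        (fun x _ y _ h ↦ by simpa using h)]
      refine Finset.sum_le_sum_of_subset fun n hn ↦ ?_
      obtain ⟨N, hN, rfl⟩ := mem_image.1 hn
      have := mem_range.1 (hS hN)
      exact mem_range.2 (by omega)
    calc ∑ N ∈ S, (biquadRep 3 (N + 1 + i) : ℝ) ≤ ((Z : ℝ) + 1 + i) ^ 3 := by exact_mod_cast h2
      _ ≤ (((Z : ℝ) + 1) * (1 + i)) ^ 3 := by
          gcongr
          have a : (0 : ℝ) ≤ (Z : ℝ) * i := by positivity
          linarith
      _ = ((Z : ℝ) + 1) ^ 3 * (1 + (i : ℝ)) ^ 3 := by ring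
      _ ≤ _ := by
          gcongr
          · exact le_add_of_nonneg_right (by positivity)
          · norm_num
  rw [quarticHalfSum, ← tsum_mul_left]
  simp only [← mul_assoc]
  exact sum_shiftedTail_le hz0 hz (summable_biquadRep_mul_pow 3 hz0 (by linarith))
    (fun i ↦ by positivity)
    ((summable_quartic_half.mul_left (((Z : ℝ) + 1) ^ 3)).congr fun i ↦ by ring) h1

lemma exists_modulus_sum_shiftedTail_le {ε : ℝ} (hε : 0 < ε) :
    ∃ M a : ℕ, 0 < M ∧ ∀ (Z : ℕ) (z : ℝ), 0 ≤ z → z ≤ 1 / 2 →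
      ∑ N ∈ (range (Z ^ 4)).filter (fun N : ℕ ↦ (N : ZMod M) = (a : ZMod M)),
        shiftedTail z (fun n ↦ (biquadRep 4 n : ℝ)) N ≤ ε * ((Z + 1 + M : ℝ) ^ 4 / M) := by
  obtain ⟨D, hD, hmod⟩ := exists_modulus_biquadCount_le
  set t : ℕ → ℝ := fun j ↦ (1 + (j : ℝ)) ^ 4 * (1 / 2) ^ j with ht
  have htend := tendsto_sum_nat_add t
  obtain ⟨L, hL⟩ := (htend.eventually (gt_mem_nhds (show 0 < ε / (2 * D) by positivity))).exists
  have hB := quarticHalfSum_nonneg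
  set η : ℝ := ε / (2 * (quarticHalfSum + 1)) with hη
  obtain ⟨M, a, hM, h1, h2⟩ := hmod L η (by positivity)
  refine ⟨M, a, hM, fun Z z hz0 hz ↦ ?_⟩
  have hM' : (0 : ℝ) < M := by exact_mod_cast hM
  set Q : ℝ := (Z + 1 + M : ℝ) ^ 4 / M with hQ
  set ind : ℕ → ℝ := fun i ↦ if i < L then 0 else D with hind
  have hind0 : ∀ i, 0 ≤ ind i := fun i ↦ by simp only [hind]; split_ifs <;> positivity
  set G : ℕ → ℝ := fun i ↦ Q * ((η + ind i) * (1 + (i : ℝ)) ^ 4) with hG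
  have hcount : ∀ i : ℕ, (biquadCount M ((a + 1 + i : ℕ) : ZMod M) : ℝ) ≤ (η + ind i) * M ^ 3 := by
    intro i
    by_cases hi : i < L
    · have := h2 (1 + i) (mem_Icc.2 ⟨by omega, by omega⟩)
      simp only [hind, if_pos hi, add_zero]
      rwa [← add_assoc] at this
    · simp only [hind, if_neg hi]
      refine (h1 _).trans (mul_le_mul_of_nonneg_right ?_ (by positivity))
      exact le_add_of_nonneg_left (by positivity)
  have hstep : ∀ i : ℕ, ∑ N ∈ (range (Z ^ 4)).filter (fun N : ℕ ↦ (N : ZMod M) = (a : ZMod M)),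
      (biquadRep 4 (N + 1 + i) : ℝ) ≤ G i := by
    intro i
    have h3 : ∑ N ∈ (range (Z ^ 4)).filter (fun N : ℕ ↦ (N : ZMod M) = (a : ZMod M)),
        biquadRep 4 (N + 1 + i)
        ≤ biquadCount M ((a + 1 + i : ℕ) : ZMod M) * ((Z + 1 + i) / M + 1) ^ 4 := by
      refine le_trans ?_ (sum_biquadRep_four_modEq_le hM (pow_four_add_le Z i) _)
      rw [← Finset.sum_image (f := fun n ↦ biquadRep 4 n) (g := fun N ↦ N + 1 + i)
        (fun x _ y _ h ↦ by simpa using h)]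
      refine Finset.sum_le_sum_of_subset fun n hn ↦ ?_
      obtain ⟨N, hN, rfl⟩ := mem_image.1 hn
      obtain ⟨hN, hN'⟩ := mem_filter.1 hN
      have := mem_range.1 hN
      refine mem_filter.2 ⟨mem_range.2 (by omega), ?_⟩
      push_cast
      rw [hN']
    have h4 : (((Z + 1 + i) / M + 1 : ℕ) : ℝ) ≤ (Z + 1 + M) * (1 + i) / M := by
      have h5 : (((Z + 1 + i) / M : ℕ) : ℝ) ≤ ((Z + 1 + i : ℕ) : ℝ) / M := Nat.cast_div_le
      push_cast at h5 ⊢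
      refine (add_le_add_left h5 1).trans ?_
      rw [div_add_one hM'.ne']
      gcongr
      have a : (0 : ℝ) ≤ (Z : ℝ) * i := by positivity
      have b : (0 : ℝ) ≤ (M : ℝ) * i := by positivity
      linarith
    calc ∑ N ∈ (range (Z ^ 4)).filter (fun N : ℕ ↦ (N : ZMod M) = (a : ZMod M)),
        (biquadRep 4 (N + 1 + i) : ℝ)
        ≤ (biquadCount M ((a + 1 + i : ℕ) : ZMod M) : ℝ)
          * (((Z + 1 + i) / M + 1 : ℕ) : ℝ) ^ 4 := by exact_mod_cast h3
      _ ≤ ((η + ind i) * M ^ 3) * ((Z + 1 + M) * (1 + i) / M) ^ 4 := by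
          gcongr
          exact hcount i
      _ = G i := by
          simp only [hG, hQ]
          field_simp
  have hsumt : Summable t := summable_quartic_half
  have hsum2 : Summable fun i ↦ ind i * t i := by
    refine Summable.of_nonneg_of_le (fun i ↦ mul_nonneg (hind0 i) (by simp only [ht]; positivity))
      (fun i ↦ mul_le_mul_of_nonneg_right (b := ind i) (c := D) ?_ (by simp only [ht]; positivity))
      (hsumt.mul_left D)
    simp only [hind]
    split_ifs
    · exact hD.le
    · exact le_rfl
  have hGt : ∀ i, G i * (1 / 2) ^ i = Q * (η * t i + ind i * t i) := fun i ↦ by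
    simp only [hG, ht]
    ring
  have hsumG : Summable fun i ↦ G i * (1 / 2) ^ i := by
    simp only [hGt]
    exact ((hsumt.mul_left η).add hsum2).mul_left Q
  refine (sum_shiftedTail_le hz0 hz (summable_biquadRep_mul_pow 4 hz0 (by linarith))
    (fun i ↦ ?_) hsumG hstep).trans ?_
  · exact mul_nonneg (by positivity)
      (mul_nonneg (add_nonneg (by positivity) (hind0 i)) (by positivity))
  simp only [hGt]
  rw [tsum_mul_left, (hsumt.mul_left η).tsum_add hsum2, tsum_mul_left, mul_comm ε]
  refine mul_le_mul_of_nonneg_left ?_ (by positivity)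
  have h5 : ∑' i, ind i * t i = D * ∑' i, t (i + L) := by
    rw [← hsum2.sum_add_tsum_nat_add L, Finset.sum_eq_zero, zero_add, ← tsum_mul_left]
    · exact tsum_congr fun i ↦ by simp [hind]
    · intro i hi
      simp [hind, mem_range.1 hi]
  have h6 : D * ∑' i, t (i + L) ≤ ε / 2 := by
    have := mul_le_mul_of_nonneg_left hL.le hD.le
    refine this.trans (le_of_eq ?_)
    field_simp
  have h7 : η * ∑' i, t i ≤ ε / 2 := by
    have e : ∑' i, t i = quarticHalfSum := rfl
    rw [e, hη, div_mul_eq_mul_div, div_le_iff₀ (by positivity)]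
    nlinarith
  rw [h5]
  linarith

end Tails

section Gaps

open Finset

lemma mul_succ_pow_four_le (h u : ℕ) :
    h * (u + 1) ^ 4 ≤ h * u ^ 4 + u ^ 4 + h * (16 * h + 1) ^ 4 := by
  rcases lt_or_ge u (16 * h) with hu | hu
  · have : h * (u + 1) ^ 4 ≤ h * (16 * h + 1) ^ 4 := by gcongr
    exact this.trans (Nat.le_add_left _ _)
  · rcases Nat.eq_zero_or_pos h with rfl | hh
    · simp
    have hu1 : 1 ≤ u := by omega
    have h1 : (u + 1) ^ 4 ≤ u ^ 4 + 16 * u ^ 3 := by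
      have a : 1 ≤ u ^ 3 := Nat.one_le_pow _ _ hu1
      have b : u ≤ u ^ 3 := Nat.le_self_pow (by norm_num) _
      have c : u ^ 2 ≤ u ^ 3 := Nat.pow_le_pow_right hu1 (by norm_num)
      nlinarith
    have h2 : h * (16 * u ^ 3) ≤ u ^ 4 := by
      calc h * (16 * u ^ 3) = (16 * h) * u ^ 3 := by ring
        _ ≤ u * u ^ 3 := by gcongr
        _ = u ^ 4 := by ring
    calc h * (u + 1) ^ 4 ≤ h * (u ^ 4 + 16 * u ^ 3) := by gcongr
      _ = h * u ^ 4 + h * (16 * u ^ 3) := by ring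
      _ ≤ h * u ^ 4 + u ^ 4 := by gcongr
      _ ≤ _ := Nat.le_add_right _ _

/-- Some translate `U + m ^ 4` of a biquadrate by an element `U ≤ N` of `s` lies beyond `N`, and
every element of `s` beyond `N` lies at distance more than `K` after it. -/
def HasIsolatedShift (s : ℕ → Prop) (X K N : ℕ) : Prop :=
  ∃ U m, s U ∧ U ≤ N ∧ N < U + m ^ 4 ∧ U + m ^ 4 ≤ 2 * X ∧ ∀ V, s V → N < V → U + m ^ 4 + K < V

lemma exists_short_gap {s : ℕ → Prop} (hs0 : s 0) {h C K X N : ℕ} (hh : 2 ≤ h)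
    (hC : ∀ u, h * (u + 1) ^ 4 ≤ h * u ^ 4 + u ^ 4 + h * C) (hX : 2 * (C + K) ≤ X) (hN : N < X)
    (hbad : ¬ HasIsolatedShift s X K N) {V : ℕ} (hNV : N < V)
    (hmin : ∀ W, s W → N < W → V ≤ W) :
    V < 2 * X ∧ ∃ U ≤ N, (∀ W, s W → U < W → V ≤ W) ∧ h * (V - N) ≤ V - U + h * (C + K) := by
  classical
  set U := Nat.findGreatest s N with hU
  have hsU : s U := Nat.findGreatest_spec (Nat.zero_le N) hs0
  have hUN : U ≤ N := Nat.findGreatest_le N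
  have hUmax : ∀ W, s W → W ≤ N → W ≤ U := fun W hW hWN ↦ Nat.le_findGreatest hWN hW
  have hex : ∃ m, N < U + m ^ 4 := ⟨N + 1, by
    have : N + 1 ≤ (N + 1) ^ 4 := Nat.le_self_pow (by norm_num) _
    omega⟩
  obtain ⟨u, hu⟩ : ∃ u, Nat.find hex = u + 1 := by
    refine Nat.exists_eq_succ_of_ne_zero fun h0 ↦ ?_
    have := Nat.find_spec hex
    rw [h0] at this
    omega
  have hu1 : N < U + (u + 1) ^ 4 := hu ▸ Nat.find_spec hex
  have hu2 : U + u ^ 4 ≤ N := not_lt.1 (Nat.find_min hex (by omega))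
  have hCu := hC u
  obtain ⟨w, hw⟩ : ∃ w, (u + 1) ^ 4 = u ^ 4 + w :=
    ⟨(u + 1) ^ 4 - u ^ 4, by have : u ^ 4 ≤ (u + 1) ^ 4 := by gcongr; omega
                             omega⟩
  rw [hw] at hCu hu1
  have hw2 : h * w ≤ u ^ 4 + h * C := by linarith [mul_add h (u ^ 4) w]
  have hw3 : 2 * w ≤ X + 2 * C := by
    have h1 : h * (w - C) ≤ u ^ 4 := by
      rw [Nat.mul_sub]
      omega
    have h2 : 2 * (w - C) ≤ h * (w - C) := by gcongr
    omega
  have hV2 : V ≤ U + (u ^ 4 + w) + K := by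
    by_contra hcon
    refine hbad ⟨U, u + 1, hsU, hUN, by rw [hw]; exact hu1, by rw [hw]; omega, fun W hW hNW ↦ ?_⟩
    rw [hw]
    exact (not_le.1 hcon).trans_le (hmin W hW hNW)
  refine ⟨by omega, U, hUN, fun W hW hUW ↦ ?_, ?_⟩
  · rcases lt_or_ge N W with hNW | hNW
    · exact hmin W hW hNW
    · exact absurd (hUmax W hW hNW) (by omega)
  · calc h * (V - N) ≤ h * (w + K) := by
          gcongr
          omega
      _ = h * w + h * K := by ring
      _ ≤ u ^ 4 + h * C + h * K := by gcongr
      _ ≤ V - U + h * C + h * K := by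
          gcongr
          omega
      _ = _ := by ring

open Classical in
lemma mul_card_not_hasIsolatedShift_le {s : ℕ → Prop} (hs0 : s 0) (hs : ∀ n, ∃ V, s V ∧ n < V)
    {h C K X : ℕ} (hh : 2 ≤ h) (hC : ∀ u, h * (u + 1) ^ 4 ≤ h * u ^ 4 + u ^ 4 + h * C)
    (hX : 2 * (C + K) ≤ X) :
    h * ((range X).filter (fun N ↦ ¬ HasIsolatedShift s X K N)).card
      ≤ 2 * X + h * (C + K) * ((range (2 * X)).filter s).card := by
  set next : ℕ → ℕ := fun n ↦ Nat.find (hs n) with hnext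
  have hn1 : ∀ n, s (next n) := fun n ↦ (Nat.find_spec (hs n)).1
  have hn2 : ∀ n, n < next n := fun n ↦ (Nat.find_spec (hs n)).2
  have hn3 : ∀ n W, s W → n < W → next n ≤ W := fun n W hW hnW ↦ Nat.find_min' (hs n) ⟨hW, hnW⟩
  set B := (range X).filter (fun N ↦ ¬ HasIsolatedShift s X K N) with hB
  have hkey : ∀ N ∈ B, next N < 2 * X ∧ ∃ U ≤ N, (∀ W, s W → U < W → next N ≤ W) ∧
      h * (next N - N) ≤ next N - U + h * (C + K) := fun N hN ↦ by
    obtain ⟨h1, h2⟩ := mem_filter.1 hN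
    exact exists_short_gap hs0 hh hC hX (mem_range.1 h1) h2 (hn2 N) (hn3 N)
  have hfib : ∀ V ∈ (range (2 * X)).filter s, h * (B.filter fun N ↦ next N = V).card
      ≤ ((range (2 * X)).filter fun N ↦ next N = V).card + h * (C + K) := by
    intro V _
    rcases (B.filter fun N ↦ next N = V).eq_empty_or_nonempty with he | hne
    · simp [he]
    set N := (B.filter fun N ↦ next N = V).min' hne with hN
    have hNmem := Finset.min'_mem _ hne
    rw [← hN] at hNmem
    obtain ⟨hNB, hNV⟩ := mem_filter.1 hNmem
    obtain ⟨hV, U, hUN, hU, hle⟩ := hkey N hNB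
    rw [hNV] at hV hU hle
    have h1 : (B.filter fun N ↦ next N = V).card ≤ V - N := by
      rw [← Nat.card_Ico]
      refine Finset.card_le_card fun N' hN' ↦ mem_Ico.2 ⟨Finset.min'_le _ _ hN', ?_⟩
      exact (mem_filter.1 hN').2 ▸ hn2 N'
    have h2 : V - U ≤ ((range (2 * X)).filter fun N ↦ next N = V).card := by
      rw [← Nat.card_Ico]
      refine Finset.card_le_card fun N' hN' ↦ ?_
      obtain ⟨h3, h4⟩ := mem_Ico.1 hN'
      refine mem_filter.2 ⟨mem_range.2 (h4.trans hV), le_antisymm ?_ ?_⟩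
      · exact hn3 N' V (hNV ▸ hn1 N) h4
      · exact hU _ (hn1 N') (h3.trans_lt (hn2 N'))
    calc h * (B.filter fun N ↦ next N = V).card ≤ h * (V - N) := by gcongr
      _ ≤ V - U + h * (C + K) := hle
      _ ≤ _ := by gcongr
  have hmaps : ∀ N ∈ B, next N ∈ (range (2 * X)).filter s := fun N hN ↦
    mem_filter.2 ⟨mem_range.2 (hkey N hN).1, hn1 N⟩
  rw [Finset.card_eq_sum_card_fiberwise hmaps, Finset.mul_sum]
  refine (Finset.sum_le_sum hfib).trans ?_
  rw [Finset.sum_add_distrib, Finset.sum_const, smul_eq_mul, mul_comm (#(filter s _))]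
  gcongr
  rw [Finset.sum_card_fiberwise_eq_card_filter]
  exact (Finset.card_le_card (Finset.filter_subset _ _)).trans (by simp)

end Gaps

section Main

open Finset

lemma biquadRep_pow_ne_zero {k : ℕ} (hk : 1 ≤ k) (n : ℕ) : biquadRep k (n ^ 4) ≠ 0 := by
  have h1 : 1 ≤ biquadRep 0 0 := by simp [biquadRep]
  have h2 := h1.trans (biquadRep_le_add_pow 0 0 n)
  rw [Nat.zero_add (n ^ 4)] at h2
  have := h2.trans (biquadRep_mono hk _)
  omega

lemma le_mul_card_filter_cast_eq {M X : ℕ} (hM : 0 < M) (hX : M ∣ X) (b : ℕ) :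
    X ≤ M * ((range X).filter (fun N : ℕ ↦ (N : ZMod M) = (b : ZMod M))).card := by
  obtain ⟨y, rfl⟩ := hX
  refine Nat.mul_le_mul_left _ ?_
  have hinj : Function.Injective fun i ↦ b % M + M * i := fun i j h ↦ by
    simpa [hM.ne'] using h
  have h1 := Finset.card_image_of_injective (range y) hinj
  rw [card_range] at h1
  refine h1.ge.trans (Finset.card_le_card fun n hn ↦ ?_)
  obtain ⟨i, hi, rfl⟩ := mem_image.1 hn
  refine mem_filter.2 ⟨mem_range.2 ?_, by simp⟩
  have := Nat.mod_lt b hM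
  calc b % M + M * i < M + M * i := by omega
    _ = M * (i + 1) := by ring
    _ ≤ M * y := Nat.mul_le_mul_left _ (mem_range.1 hi)

lemma card_filter_biquadRep_three_ne_zero_le (Z : ℕ) :
    ((range (2 * Z ^ 4)).filter (fun n ↦ biquadRep 3 n ≠ 0)).card ≤ (2 * Z) ^ 3 := by
  refine le_trans ?_ (sum_biquadRep_le 3 (show 2 * Z ^ 4 ≤ (2 * Z) ^ 4 by nlinarith [Nat.zero_le (Z ^ 4)]))
  rw [Finset.card_filter]
  refine Finset.sum_le_sum fun n _ ↦ ?_
  split_ifs <;> omega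

lemma eventually_mul_pow_lt_two_pow (R : ℝ) (k : ℕ) :
    ∀ᶠ W : ℕ in Filter.atTop, R * (W : ℝ) ^ k < 2 ^ W := by
  have h := (tendsto_pow_const_div_const_pow_of_one_lt k (one_lt_two (α := ℝ))).const_mul R
  rw [mul_zero] at h
  filter_upwards [h.eventually (gt_mem_nhds one_pos)] with W hW
  rwa [← mul_div_assoc, div_lt_one (by positivity)] at hW

/-- The coefficient of `z ^ n` in the power series of `∑ k < 5, a k * (∑ n, z ^ n ^ 4) ^ k`. -/
noncomputable def quarticCoeff (a : ℕ → ℤ) (n : ℕ) : ℤ := ∑ k ∈ range 5, a k * biquadRep k n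

lemma abs_quarticCoeff_sub_le (a : ℕ → ℤ) (n : ℕ) :
    |quarticCoeff a n - a 4 * biquadRep 4 n| ≤ (∑ k ∈ range 4, |a k|) * biquadRep 3 n := by
  rw [quarticCoeff, Finset.sum_range_succ, add_sub_cancel_right, Finset.sum_mul]
  refine (Finset.abs_sum_le_sum_abs _ _).trans (Finset.sum_le_sum fun k hk ↦ ?_)
  rw [abs_mul, Nat.abs_cast]
  have := biquadRep_mono (Nat.lt_succ_iff.1 (mem_range.1 hk)) n
  gcongr

lemma hasSum_quarticCoeff (a : ℕ → ℤ) {z : ℝ} (hz0 : 0 ≤ z) (hz1 : z < 1) :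
    HasSum (fun n ↦ (quarticCoeff a n : ℝ) * z ^ n)
      (∑ k ∈ range 5, (a k : ℝ) * (∑' n : ℕ, z ^ n ^ 4) ^ k) := by
  have h : ∀ k ∈ range 5, HasSum (fun n ↦ (a k : ℝ) * ((biquadRep k n : ℝ) * z ^ n))
      ((a k : ℝ) * (∑' n : ℕ, z ^ n ^ 4) ^ k) := fun k _ ↦ by
    rw [← tsum_biquadRep_mul_pow k hz0 hz1]
    exact (summable_biquadRep_mul_pow k hz0 hz1).hasSum.mul_left _
  refine (hasSum_sum h).congr_fun fun n ↦ ?_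
  rw [quarticCoeff]
  push_cast
  rw [Finset.sum_mul]
  exact Finset.sum_congr rfl fun k _ ↦ by ring

lemma one_le_shiftedTail_quarticCoeff {q : ℕ} (hq : 2 ≤ q) {a : ℕ → ℤ} (ha : 0 < a 4)
    (h0 : ∑ k ∈ range 5, (a k : ℝ) * (∑' n : ℕ, (1 / (q : ℝ)) ^ n ^ 4) ^ k = 0) {X K N : ℕ}
    (hsmall : ((∑ k ∈ range 4, |a k| : ℤ) : ℝ) * (2 * (X : ℝ) + 1) ^ 3 * ((K : ℝ) + 2) ^ 3 *
      quarticHalfSum < 2 ^ (K + 1))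
    (hN : HasIsolatedShift (fun n ↦ biquadRep 3 n ≠ 0) X K N) :
    1 ≤ shiftedTail (1 / (q : ℝ)) (fun n ↦ (quarticCoeff a n : ℝ)) N := by
  have hq' : (2 : ℝ) ≤ q := by exact_mod_cast hq
  have hz0 : 0 < 1 / (q : ℝ) := by positivity
  have hz : 1 / (q : ℝ) ≤ 1 / 2 := one_div_le_one_div_of_le two_pos hq'
  have hsum := hasSum_quarticCoeff a hz0.le (by linarith : 1 / (q : ℝ) < 1)
  obtain ⟨t, ht⟩ := exists_int_eq_shiftedTail (by omega) hsum.summable (hsum.tsum_eq.trans h0) N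
  have hA : 0 ≤ ∑ k ∈ range 4, |a k| := Finset.sum_nonneg fun _ _ ↦ abs_nonneg _
  obtain ⟨U, m, hU, hUN, hNm, hmX, hgap⟩ := hN
  have hzero : ∀ n, N < n → n ≤ U + m ^ 4 + K → quarticCoeff a n = a 4 * biquadRep 4 n := by
    intro n h1 h2
    have h3 : biquadRep 3 n = 0 := by
      by_contra h
      exact absurd (hgap n h h1) (by omega)
    have h4 := abs_quarticCoeff_sub_le a n
    rw [h3, Nat.cast_zero, mul_zero] at h4
    exact sub_eq_zero.1 (abs_nonpos_iff.1 h4)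
  have hpos : 0 < shiftedTail (1 / (q : ℝ)) (fun n ↦ (quarticCoeff a n : ℝ)) N := by
    refine shiftedTail_pos (A := ((∑ k ∈ range 4, |a k| : ℤ) : ℝ)) hz0 hz
      (by exact_mod_cast hA) hsum.summable (fun n ↦ ?_) hNm ?_ (fun n h1 h2 ↦ ?_)
      (lt_of_le_of_lt ?_ hsmall)
    · have h1 := (abs_le.1 (abs_quarticCoeff_sub_le a n)).1
      have h2 : (0 : ℤ) ≤ a 4 * biquadRep 4 n := by positivity
      have h3 : (∑ k ∈ range 4, |a k|) * (biquadRep 3 n : ℤ)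
          ≤ (∑ k ∈ range 4, |a k|) * ((n : ℤ) + 1) ^ 3 :=
        mul_le_mul_of_nonneg_left (by exact_mod_cast biquadRep_le 3 n) hA
      have h4 : -((∑ k ∈ range 4, |a k|) * ((n : ℤ) + 1) ^ 3) ≤ quarticCoeff a n := by linarith
      exact_mod_cast h4
    · have h1 : (1 : ℤ) ≤ biquadRep 4 (U + m ^ 4) := by
        have : biquadRep 3 U ≤ biquadRep 4 (U + m ^ 4) := biquadRep_le_add_pow 3 U m
        have : 1 ≤ biquadRep 4 (U + m ^ 4) := by omega
        exact_mod_cast this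
      have h2 : (1 : ℤ) ≤ quarticCoeff a (U + m ^ 4) := by
        rw [hzero _ hNm (by omega)]
        nlinarith
      exact_mod_cast h2
    · have h3 : 0 ≤ quarticCoeff a n := by
        rw [hzero n h1 h2]
        positivity
      exact_mod_cast h3
    · have h1 : ((U + m ^ 4 : ℕ) : ℝ) ≤ 2 * X := by exact_mod_cast hmX
      have hA' : (0 : ℝ) ≤ ((∑ k ∈ range 4, |a k| : ℤ) : ℝ) := by exact_mod_cast hA
      have := quarticHalfSum_nonneg
      gcongr
  rw [← ht] at hpos ⊢
  have : 0 < t := by exact_mod_cast hpos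
  exact_mod_cast this

lemma card_le_sum_shiftedTail {q : ℕ} (hq : 2 ≤ q) {a : ℕ → ℤ} (ha : 0 < a 4)
    {S G : Finset ℕ} (hG : G ⊆ S)
    (h : ∀ N ∈ G, 1 ≤ shiftedTail (1 / (q : ℝ)) (fun n ↦ (quarticCoeff a n : ℝ)) N) :
    (G.card : ℝ) ≤ a 4 * ∑ N ∈ S, shiftedTail (1 / (q : ℝ)) (fun n ↦ (biquadRep 4 n : ℝ)) N
      + ((∑ k ∈ range 4, |a k| : ℤ) : ℝ) *
        ∑ N ∈ S, shiftedTail (1 / (q : ℝ)) (fun n ↦ (biquadRep 3 n : ℝ)) N := by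
  have hq' : (2 : ℝ) ≤ q := by exact_mod_cast hq
  have hz0 : 0 < 1 / (q : ℝ) := by positivity
  have hz : 1 / (q : ℝ) ≤ 1 / 2 := one_div_le_one_div_of_le two_pos hq'
  have hz1 : 1 / (q : ℝ) < 1 := by linarith
  have hsum := hasSum_quarticCoeff a hz0.le hz1
  have hA : 0 ≤ ∑ k ∈ range 4, |a k| := Finset.sum_nonneg fun _ _ ↦ abs_nonneg _
  set A := ∑ k ∈ range 4, |a k| with hAdef
  have hs4 := summable_biquadRep_mul_pow 4 hz0.le hz1
  have hs3 := summable_biquadRep_mul_pow 3 hz0.le hz1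
  set g : ℕ → ℝ := fun n ↦ a 4 * biquadRep 4 n + A * biquadRep 3 n with hg
  have hsg : Summable fun n ↦ g n * (1 / (q : ℝ)) ^ n := by
    refine ((hs4.mul_left (a 4 : ℝ)).add (hs3.mul_left (A : ℝ))).congr fun n ↦ ?_
    simp only [hg]
    ring
  have hg0 : ∀ n, 0 ≤ g n := fun n ↦ by
    have h1 : (0 : ℤ) ≤ a 4 * biquadRep 4 n + A * biquadRep 3 n := by positivity
    simp only [hg]
    exact_mod_cast h1
  have hle : ∀ n, (quarticCoeff a n : ℝ) ≤ g n := fun n ↦ by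
    have h1 := (abs_le.1 (abs_quarticCoeff_sub_le a n)).2
    have h2 : quarticCoeff a n ≤ a 4 * biquadRep 4 n + A * biquadRep 3 n := by linarith
    simp only [hg]
    exact_mod_cast h2
  have htail : ∀ N, shiftedTail (1 / (q : ℝ)) g N
      = a 4 * shiftedTail (1 / (q : ℝ)) (fun n ↦ (biquadRep 4 n : ℝ)) N
        + A * shiftedTail (1 / (q : ℝ)) (fun n ↦ (biquadRep 3 n : ℝ)) N := fun N ↦ by
    simp only [shiftedTail]
    rw [← tsum_mul_left, ← tsum_mul_left,
      ← ((summable_shiftedTail hs4 N).mul_left _).tsum_add ((summable_shiftedTail hs3 N).mul_left _)]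
    exact tsum_congr fun i ↦ by simp only [hg]; ring
  rw [Finset.mul_sum, Finset.mul_sum, ← Finset.sum_add_distrib]
  calc (G.card : ℝ) = ∑ N ∈ G, (1 : ℝ) := by simp
    _ ≤ ∑ N ∈ G, shiftedTail (1 / (q : ℝ)) g N :=
        Finset.sum_le_sum fun N hN ↦ (h N hN).trans
          (shiftedTail_mono hz0.le hsum.summable hsg hle N)
    _ ≤ ∑ N ∈ S, shiftedTail (1 / (q : ℝ)) g N :=
        Finset.sum_le_sum_of_subset_of_nonneg hG fun N _ _ ↦
          tsum_nonneg fun i ↦ mul_nonneg (hg0 _) (by positivity)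
    _ = _ := Finset.sum_congr rfl fun N _ ↦ htail N

lemma sum_mul_pow_ne_zero {q : ℕ} (hq : 2 ≤ q) {a : ℕ → ℤ} (ha : 0 < a 4) :
    ∑ k ∈ range 5, (a k : ℝ) * (∑' n : ℕ, (1 / (q : ℝ)) ^ n ^ 4) ^ k ≠ 0 := by
  classical
  intro h0
  have hq' : (2 : ℝ) ≤ q := by exact_mod_cast hq
  have hz0 : 0 < 1 / (q : ℝ) := by positivity
  have hz : 1 / (q : ℝ) ≤ 1 / 2 := one_div_le_one_div_of_le two_pos hq'
  have hA : (0 : ℝ) ≤ ((∑ k ∈ range 4, |a k| : ℤ) : ℝ) := by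
    exact_mod_cast Finset.sum_nonneg fun k _ ↦ abs_nonneg (a k)
  set A : ℝ := ((∑ k ∈ range 4, |a k| : ℤ) : ℝ) with hAdef
  have ha' : (0 : ℝ) < a 4 := by exact_mod_cast ha
  have hB := quarticHalfSum_nonneg
  set B := quarticHalfSum with hBdef
  obtain ⟨M, b, hM, hmod⟩ := exists_modulus_sum_shiftedTail_le
    (ε := 1 / (128 * a 4)) (by positivity)
  have hM' : (0 : ℝ) < M := by exact_mod_cast hM
  set C : ℕ := (16 * (16 * M) + 1) ^ 4 with hC
  obtain ⟨W₀, hW₀⟩ := Filter.eventually_atTop.1 (eventually_mul_pow_lt_two_pow (729 * A * B) 27)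
  obtain ⟨W, hMW, hW0, hW1, hW2⟩ : ∃ W : ℕ, M ∣ W ∧ W₀ ≤ W ∧ 32 * M ≤ W ∧ C + ⌈A * B⌉₊ ≤ W := by
    refine ⟨M * (W₀ + 32 + (C + ⌈A * B⌉₊)), Dvd.intro _ rfl, ?_, ?_, ?_⟩ <;> nlinarith
  have hWpos : 1 ≤ W := by omega
  have hWr : (1 : ℝ) ≤ W := by exact_mod_cast hWpos
  have hW2' : (C : ℝ) + A * B ≤ W := by
    have h1 : ((C + ⌈A * B⌉₊ : ℕ) : ℝ) ≤ W := by exact_mod_cast hW2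
    push_cast at h1
    linarith [Nat.le_ceil (A * B)]
  have hW1' : 32 * (M : ℝ) ≤ W := by exact_mod_cast hW1
  set X : ℕ := (W ^ 2) ^ 4 with hX
  set S := (range X).filter (fun N : ℕ ↦ (N : ZMod M) = (b : ZMod M)) with hS
  set s : ℕ → Prop := fun n ↦ biquadRep 3 n ≠ 0 with hs
  set G := S.filter (fun N ↦ HasIsolatedShift s X W N) with hG
  have hCW : 2 * (C + W) ≤ X := by
    have h1 : W ^ 2 ≤ X := Nat.le_self_pow (by norm_num) _
    nlinarith
  have hgood : ∀ N ∈ G, 1 ≤ shiftedTail (1 / (q : ℝ)) (fun n ↦ (quarticCoeff a n : ℝ)) N := by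
    intro N hN
    refine one_le_shiftedTail_quarticCoeff hq ha h0 (lt_of_le_of_lt ?_ ((hW₀ W hW0).trans
      (pow_lt_pow_right₀ one_lt_two (Nat.lt_succ_self W)))) (mem_filter.1 hN).2
    have e1 : 2 * (X : ℝ) + 1 ≤ 3 * (W : ℝ) ^ 8 := by
      have : (1 : ℝ) ≤ (W : ℝ) ^ 8 := one_le_pow₀ hWr
      have e : (X : ℝ) = (W : ℝ) ^ 8 := by rw [hX]; push_cast; ring
      rw [e]
      linarith
    have e2 : (W : ℝ) + 2 ≤ 3 * W := by linarith
    calc A * (2 * (X : ℝ) + 1) ^ 3 * ((W : ℝ) + 2) ^ 3 * B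
        ≤ A * (3 * (W : ℝ) ^ 8) ^ 3 * (3 * (W : ℝ)) ^ 3 * B := by gcongr
      _ = 729 * A * B * (W : ℝ) ^ 27 := by ring
  have hbad := mul_card_not_hasIsolatedShift_le (s := s) (h := 16 * M) (C := C) (K := W) (X := X)
    (by simpa using biquadRep_pow_ne_zero (k := 3) (by norm_num) 0)
    (fun n ↦ ⟨(n + 1) ^ 4, biquadRep_pow_ne_zero (by norm_num) _,
      (Nat.lt_succ_self n).trans_le (Nat.le_self_pow (by norm_num) _)⟩)
    (by omega) (mul_succ_pow_four_le _) hCW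
  set b₀ := ((range X).filter (fun N ↦ ¬ HasIsolatedShift s X W N)).card with hb₀
  have hscard : ((range (2 * X)).filter s).card ≤ (2 * W ^ 2) ^ 3 := by
    convert card_filter_biquadRep_three_ne_zero_le (W ^ 2)
  have hSG : S.card ≤ G.card + b₀ := by
    rw [← Finset.card_filter_add_card_filter_not (s := S) (fun N ↦ HasIsolatedShift s X W N)]
    refine Nat.add_le_add_left (Finset.card_le_card ?_) _
    exact Finset.filter_subset_filter _ (Finset.filter_subset _ _)
  have hXS := le_mul_card_filter_cast_eq hM
    (show M ∣ X from (hMW.trans (dvd_pow_self W (by norm_num))).trans (dvd_pow_self _ (by norm_num))) b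
  rw [← hS] at hXS
  have hcard := card_le_sum_shiftedTail hq ha (Finset.filter_subset _ _ : G ⊆ S) hgood
  have h4 := hmod (W ^ 2) (1 / (q : ℝ)) hz0.le hz
  have h3 := sum_shiftedTail_biquadRep_three_le hz0.le hz (W ^ 2) (Finset.filter_subset _ _ : S ⊆ range X)
  rw [← hX, ← hS] at h4
  set T4 := ∑ N ∈ S, shiftedTail (1 / (q : ℝ)) (fun n ↦ (biquadRep 4 n : ℝ)) N
  set T3 := ∑ N ∈ S, shiftedTail (1 / (q : ℝ)) (fun n ↦ (biquadRep 3 n : ℝ)) N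
  have hXr : (X : ℝ) = (W : ℝ) ^ 8 := by rw [hX]; push_cast; ring
  have h4' : M * (a 4 * T4) ≤ (W : ℝ) ^ 8 / 8 := by
    have e1 : ((W ^ 2 : ℕ) : ℝ) + 1 + M ≤ 2 * (W : ℝ) ^ 2 := by
      have hM1 : (1 : ℝ) ≤ M := by exact_mod_cast hM
      push_cast
      nlinarith
    have e2 : (((W ^ 2 : ℕ) : ℝ) + 1 + M) ^ 4 ≤ (2 * (W : ℝ) ^ 2) ^ 4 := by gcongr
    calc M * (a 4 * T4)
        ≤ M * (a 4 * (1 / (128 * a 4) * ((((W ^ 2 : ℕ) : ℝ) + 1 + M) ^ 4 / M))) := by gcongr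
      _ = (((W ^ 2 : ℕ) : ℝ) + 1 + M) ^ 4 / 128 := by field_simp
      _ ≤ (2 * (W : ℝ) ^ 2) ^ 4 / 128 := by gcongr
      _ = _ := by ring
  have h3' : A * T3 ≤ 8 * (A * B) * (W : ℝ) ^ 6 := by
    have e1 : ((W ^ 2 : ℕ) : ℝ) + 1 ≤ 2 * (W : ℝ) ^ 2 := by
      push_cast
      nlinarith
    calc A * T3 ≤ A * ((((W ^ 2 : ℕ) : ℝ) + 1) ^ 3 * B) := by gcongr
      _ ≤ A * ((2 * (W : ℝ) ^ 2) ^ 3 * B) := by gcongr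
      _ = _ := by ring
  have hbad' : (M : ℝ) * b₀ ≤ (W : ℝ) ^ 8 / 8 + 8 * M * (C + W) * (W : ℝ) ^ 6 := by
    have e1 : 16 * M * b₀ ≤ 2 * X + 16 * M * (C + W) * (2 * W ^ 2) ^ 3 := by
      refine hbad.trans (Nat.add_le_add_left (Nat.mul_le_mul_left _ ?_) _)
      convert hscard
    have e2 : 16 * (M : ℝ) * b₀ ≤ 2 * X + 16 * M * (C + W) * (2 * (W : ℝ) ^ 2) ^ 3 := by
      exact_mod_cast e1
    rw [hXr] at e2
    linarith [show 16 * (M : ℝ) * (C + W) * (2 * (W : ℝ) ^ 2) ^ 3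
      = 16 * (8 * M * (C + W) * (W : ℝ) ^ 6) by ring]
  have hXS' : (W : ℝ) ^ 8 ≤ M * S.card := by
    rw [← hXr]
    exact_mod_cast hXS
  have hSG' : (S.card : ℝ) ≤ G.card + b₀ := by exact_mod_cast hSG
  have hfin : (W : ℝ) ^ 8 ≤ (W : ℝ) ^ 8 / 4 + 8 * M * (C + W + A * B) * (W : ℝ) ^ 6 := by
    have e1 : (M : ℝ) * S.card ≤ M * (a 4 * T4 + 8 * (A * B) * (W : ℝ) ^ 6 + b₀) := by
      gcongr
      linarith
    linarith
  have hlast : 8 * M * (C + W + A * B) * (W : ℝ) ^ 6 ≤ (W : ℝ) ^ 8 / 2 := by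
    calc 8 * M * (C + W + A * B) * (W : ℝ) ^ 6 ≤ 8 * M * (2 * W) * (W : ℝ) ^ 6 := by
          gcongr
          linarith
      _ = (32 * M) * ((W : ℝ) ^ 7 / 2) := by ring
      _ ≤ W * ((W : ℝ) ^ 7 / 2) := by gcongr
      _ = _ := by ring
  have : (0 : ℝ) < (W : ℝ) ^ 8 := by positivity
  linarith

lemma theta4_eq_tsum_pow (q : ℕ) : theta4 q = ∑' n : ℕ, (1 / (q : ℝ)) ^ n ^ 4 :=
  tsum_congr fun n ↦ by rw [one_div_pow]

open Polynomial in
lemma aeval_theta4_ne_zero {q : ℕ} (hq : 2 ≤ q) {P : ℤ[X]} (hP : P ≠ 0) (hdeg : P.natDegree ≤ 4) :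
    aeval (theta4 q) P ≠ 0 := by
  intro h
  wlog hlead : 0 < P.leadingCoeff generalizing P
  · refine this (neg_ne_zero.2 hP) (by rwa [natDegree_neg]) (by rw [map_neg, h, neg_zero]) ?_
    rw [leadingCoeff_neg, neg_pos]
    exact lt_of_le_of_ne (not_lt.1 hlead) (leadingCoeff_ne_zero.2 hP)
  set Q := P * X ^ (4 - P.natDegree) with hQ
  have hQd : Q.natDegree = 4 := by
    rw [hQ, natDegree_mul_X_pow _ hP]
    omega
  have hQ4 : Q.coeff 4 = P.leadingCoeff := by
    rw [hQ, coeff_mul_X_pow', if_pos (by omega), leadingCoeff]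
    congr 1
    omega
  refine sum_mul_pow_ne_zero hq (a := Q.coeff) (by rwa [hQ4]) ?_
  rw [← theta4_eq_tsum_pow]
  have h1 : aeval (theta4 q) Q = 0 := by rw [hQ, map_mul, h, zero_mul]
  rw [aeval_eq_sum_range, hQd] at h1
  simpa using h1

end Main

/-- For an integer `q ≥ 2`, the number `θ₄(q)` is not a root of any nonzero
polynomial with integer coefficients of degree at most `4`; equivalently,
`1, θ₄(q), θ₄(q)², θ₄(q)³, θ₄(q)⁴` are linearly independent over `ℚ`. -/
theorem theta4_not_algebraic_of_degree_le_four (q : ℕ) (hq : 2 ≤ q) :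
    (∀ P : Polynomial ℤ, P ≠ 0 → P.natDegree ≤ 4 →
      Polynomial.aeval (theta4 q) P ≠ 0) ∧
    LinearIndependent ℚ ![1, theta4 q, theta4 q ^ 2, theta4 q ^ 3, theta4 q ^ 4] := by
  refine ⟨fun P hP hdeg ↦ aeval_theta4_ne_zero hq hP hdeg, ?_⟩
  have hv : ![1, theta4 q, theta4 q ^ 2, theta4 q ^ 3, theta4 q ^ 4]
      = fun i : Fin 5 ↦ theta4 q ^ (i : ℕ) := by
    ext i
    fin_cases i <;> simp
  rw [hv, ← LinearIndependent.iff_fractionRing (R := ℤ), Fintype.linearIndependent_iff]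
  intro g hg
  set P : Polynomial ℤ := ∑ i : Fin 5, Polynomial.monomial (i : ℕ) (g i) with hP
  have hcoeff : ∀ i : Fin 5, P.coeff i = g i := fun i ↦ by
    simp [hP, Polynomial.coeff_monomial, Fin.val_inj]
  have hdeg : P.natDegree ≤ 4 := by
    refine Polynomial.natDegree_sum_le_of_forall_le _ _ fun i _ ↦ ?_
    exact (Polynomial.natDegree_monomial_le _).trans (by omega)
  have haeval : Polynomial.aeval (theta4 q) P = 0 := by
    rw [hP, map_sum, ← hg]
    exact Finset.sum_congr rfl fun i _ ↦ by simp [Polynomial.aeval_monomial]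
  have hP0 : P = 0 := by
    by_contra h
    exact aeval_theta4_ne_zero hq h hdeg haeval
  intro i
  rw [← hcoeff, hP0, Polynomial.coeff_zero]
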